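/- arXiv:1210.6367 — 3 statements merged into one kernel-verified Lean document; each statement's English description precedes it below -/
import Mathlib

section
/- Let p(X₁…X_k | A₁…A_k) be a permutation-invariant non-signaling conditional probability distribution (invariant under simultaneous permutation of the output systems X_j and input systems A_j), with each output alphabet equal to X. Fix a product distribution μ = μ₁ × ⋯ × μ_k on the inputs A₁ × ⋯ × A_k. Then for every 0 < l < k there is a finitely supported probability measure ν on single-system conditional probability distributions q(x|a) such that E_{(a₁,…,a_l)∼μ} ‖ p(X₁…X_l | a₁,…,a_l) − E_{q∼ν} q(X₁|a₁) ⊗ ⋯ ⊗ q(X_l|a_l) ‖₁ ≤ √( 2 l² ln|X| / (k − l) ). -/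
/- Multipartite de Finetti theorem for non-signaling distributions (Theorem multi, part 2):
   for a permutation-invariant non-signaling conditional distribution p(X₁…X_k|A₁…A_k) and
   a product distribution μ on the inputs, for every 0 < l < k there is a finitely supported
   measure ν on single-system conditional distributions with
   E_{(a₁,…,a_l)∼μ} ‖p(X₁…X_l|a₁,…,a_l) − E_{q∼ν} q(X₁|a₁)⊗⋯⊗q(X_l|a_l)‖₁
     ≤ √(2 l² ln|X| / (k−l)). -/

open scoped BigOperators

/-- Non-signaling for a k-system conditional distribution: summing out any single output
    gives a marginal independent of the corresponding input. -/
def IsNonSignalingK {X A : Type} [Fintype X] {k : ℕ}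
    (p : (Fin k → X) → (Fin k → A) → ℝ) : Prop :=
  ∀ (j : Fin k) (xv : Fin k → X) (av : Fin k → A) (a' : A),
    (∑ c : X, p (Function.update xv j c) av) =
      ∑ c : X, p (Function.update xv j c) (Function.update av j a')

/-- The marginal of p on the first l output systems, given full inputs `av` (l ≤ k). -/
def margFirst {X A : Type} [Fintype X] {k l : ℕ} (_ : l ≤ k)
    (p : (Fin k → X) → (Fin k → A) → ℝ) (av : Fin k → A) (xv : Fin l → X) : ℝ :=
  ∑ h : {i : Fin k // ¬ (i : ℕ) < l} → X,
    p (fun i => if hi : (i : ℕ) < l then xv ⟨i, hi⟩ else h ⟨i, hi⟩) av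

/-- Replace the first l inputs of `ext` by `f`. -/
def overrideFirst {A : Type} {k l : ℕ} (ext : Fin k → A) (f : Fin l → A) : Fin k → A :=
  fun i => if h : (i : ℕ) < l then f ⟨i, h⟩ else ext i

set_option linter.unusedSectionVars false

namespace DF

/-- pointwise Pinsker-type log bound -/
lemma log_bound (t : ℝ) (ht : 0 < t) : 5/2 - 1/(4*t) - 27/(4*(t+2)) ≤ Real.log t := by
  set h : ℝ → ℝ := fun t => Real.log t + 1/4 * t⁻¹ + 27/4 * (t+2)⁻¹ with hh
  have hd : ∀ t : ℝ, 0 < t → HasDerivAt h ((t-1)^3/(t^2*(t+2)^2)) t := by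
    intro t ht
    have h1 := Real.hasDerivAt_log ht.ne'
    have h2 := (hasDerivAt_inv ht.ne').const_mul (1/4 : ℝ)
    have h3 := (((hasDerivAt_id t).add_const (2:ℝ)).inv (by simp; positivity)).const_mul (27/4 : ℝ)
    have := (h1.add h2).add h3
    refine this.congr_deriv ?_
    simp only [id]
    have : t + 2 ≠ 0 := by positivity
    field_simp
    ring
  have key : h 1 ≤ h t := by
    rcases le_total 1 t with h1 | h1
    · have : MonotoneOn h (Set.Ici 1) := by
        apply monotoneOn_of_deriv_nonneg (convex_Ici 1)
        · intro x hx
          exact (hd x (by simp at hx; linarith)).continuousAt.continuousWithinAt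
        · intro x hx
          simp at hx
          exact (hd x (by linarith)).differentiableAt.differentiableWithinAt
        · intro x hx
          simp at hx
          rw [(hd x (by linarith)).deriv]
          have : 0 ≤ x - 1 := by linarith
          positivity
      exact this (by simp) h1 h1
    · have : AntitoneOn h (Set.Ioc 0 1) := by
        apply antitoneOn_of_deriv_nonpos (convex_Ioc 0 1)
        · intro x hx
          exact (hd x hx.1).continuousAt.continuousWithinAt
        · intro x hx
          simp at hx
          exact (hd x (by linarith)).differentiableAt.differentiableWithinAt
        · intro x hx
          simp at hx
          rw [(hd x (by linarith)).deriv]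
          apply div_nonpos_of_nonpos_of_nonneg
          · have : 0 ≤ 1 - x := by linarith
            have : 0 ≤ (1-x)^3 := by positivity
            nlinarith
          · positivity
      exact this ⟨ht, h1⟩ (by simp) h1
  simp only [hh] at key
  norm_num at key
  have e1 : 1/(4*t) = 1/4 * t⁻¹ := by field_simp
  have e2 : 27/(4*(t+2)) = 27/4 * (t+2)⁻¹ := by field_simp
  rw [e1, e2]; linarith

lemma pinsker_pt (u v c : ℝ) (hu : 0 ≤ u) (hv : 0 ≤ v) (hc : 0 < c) (huv : v = 0 → u = 0) :
    |u - v| ≤ c * ((u + 2 * v) / 3) + 1 / (2 * c) * (u * Real.log u - u * Real.log v - u + v) := by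
  rcases hv.eq_or_lt with h | hv
  · have := huv h.symm
    subst h; subst this; simp
  have key : 3 * (u-v)^2 / (2*(u+2*v)) ≤ u * Real.log u - u * Real.log v - u + v := by
    rcases hu.eq_or_lt with h | hu
    · subst h
      simp
      rw [div_le_iff₀ (by positivity)]
      nlinarith
    · have := log_bound (u/v) (by positivity)
      rw [Real.log_div hu.ne' hv.ne'] at this
      have h2 := mul_le_mul_of_nonneg_left this hu.le
      have e : u * (5/2 - 1/(4*(u/v)) - 27/(4*(u/v+2))) = 3 * (u-v)^2 / (2*(u+2*v)) + u - v := by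
        have : u + 2 * v ≠ 0 := by positivity
        have : u / v + 2 ≠ 0 := by positivity
        field_simp
        ring
      rw [e] at h2
      linarith
  have hw : 0 < u + 2 * v := by positivity
  have h3 : |u - v| ≤ c * ((u + 2 * v) / 3) + 1 / (2 * c) * (3 * (u-v)^2 / (2*(u+2*v))) := by
    have e : c * ((u + 2 * v) / 3) + 1 / (2 * c) * (3 * (u-v)^2 / (2*(u+2*v)))
       = |u - v| + ((2 * c * (u+2*v) - 3 * |u-v|)^2 + 3 * c * (u+2*v) * 0 + 4 * c^2 * (u+2*v)^2 * 0) / (12 * c * (u+2*v)) + 0 := by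
      rw [← sq_abs (u-v)]
      field_simp
      ring
    have h0 : 0 ≤ ((2 * c * (u+2*v) - 3 * |u-v|)^2 + 3 * c * (u+2*v) * 0 + 4 * c^2 * (u+2*v)^2 * 0) / (12 * c * (u+2*v)) := by
      have : 0 ≤ (2 * c * (u+2*v) - 3 * |u-v|)^2 := sq_nonneg _
      simp only [mul_zero, add_zero]
      positivity
    linarith
  have := mul_le_mul_of_nonneg_left key (by positivity : 0 ≤ 1 / (2*c))
  linarith

lemma sqrt_opt (x D : ℝ) (hD : 0 ≤ D) (h : ∀ c : ℝ, 0 < c → x ≤ c + 1 / (2 * c) * D) :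
    x ≤ Real.sqrt (2 * D) := by
  rcases hD.eq_or_lt with h0 | h0
  · subst h0
    simp
    refine le_of_forall_pos_le_add (fun e he => ?_)
    simpa using h e he
  · have hs : 0 < Real.sqrt (2 * D) := Real.sqrt_pos.2 (by linarith)
    have := h (Real.sqrt (2*D) / 2) (by positivity)
    have e : 1 / (2 * (Real.sqrt (2*D) / 2)) * D = Real.sqrt (2*D) / 2 := by
      have := Real.mul_self_sqrt (show 0 ≤ 2 * D by linarith)
      field_simp
      nlinarith
    rw [e] at this; linarith
end DF
namespace DF
section
variable {X A : Type} [Fintype X] [Fintype A]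

/-- A probability vector on inputs. -/
def IsLaw (m : A → ℝ) : Prop := (∀ a, 0 ≤ m a) ∧ ∑ a, m a = 1

/-- Iterated weighted sum over lists of (input, output) pairs. -/
noncomputable def S : List (A → ℝ) → (List (A × X) → ℝ) → ℝ
  | [], F => F []
  | m :: M, F => ∑ a, m a * ∑ x, S M (fun L => F ((a, x) :: L))

lemma S_mono (M : List (A → ℝ)) (hM : ∀ m ∈ M, IsLaw m) (F G : List (A × X) → ℝ)
    (h : ∀ L, L.length = M.length → F L ≤ G L) : S M F ≤ S M G := by
  induction M generalizing F G with
  | nil => exact h [] rfl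
  | cons m M ih =>
    simp only [S]
    refine Finset.sum_le_sum fun a _ => mul_le_mul_of_nonneg_left ?_ ((hM m (by simp)).1 a)
    refine Finset.sum_le_sum fun x _ => ih (fun m' h' => hM m' (by simp [h'])) _ _ ?_
    intro L hL
    exact h _ (by simp [hL])

lemma S_congr (M : List (A → ℝ)) (F G : List (A × X) → ℝ)
    (h : ∀ L, L.length = M.length → F L = G L) : S M F = S M G := by
  induction M generalizing F G with
  | nil => exact h [] rfl
  | cons m M ih =>
    simp only [S]
    refine Finset.sum_congr rfl fun a _ => ?_
    congr 1
    refine Finset.sum_congr rfl fun x _ => ih _ _ ?_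
    intro L hL
    exact h _ (by simp [hL])

lemma S_add (M : List (A → ℝ)) (F G : List (A × X) → ℝ) :
    S M (fun L => F L + G L) = S M F + S M G := by
  induction M generalizing F G with
  | nil => rfl
  | cons m M ih =>
    simp only [S, ih, Finset.sum_add_distrib, mul_add]

lemma S_smul (M : List (A → ℝ)) (c : ℝ) (F : List (A × X) → ℝ) :
    S M (fun L => c * F L) = c * S M F := by
  induction M generalizing F with
  | nil => rfl
  | cons m M ih =>
    simp only [S, ih, Finset.mul_sum]
    refine Finset.sum_congr rfl fun a _ => Finset.sum_congr rfl fun x _ => ?_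
    ring

lemma S_neg (M : List (A → ℝ)) (F : List (A × X) → ℝ) :
    S M (fun L => - F L) = - S M F := by
  have := S_smul M (-1) F
  simpa using this

lemma S_sub (M : List (A → ℝ)) (F G : List (A × X) → ℝ) :
    S M (fun L => F L - G L) = S M F - S M G := by
  simp only [sub_eq_add_neg, S_add, S_neg]

lemma S_zero (M : List (A → ℝ)) : S M (fun _ : List (A × X) => (0:ℝ)) = 0 := by
  have := S_smul M 0 (fun _ : List (A × X) => (0:ℝ))
  simpa using this

lemma S_sum {ι : Type*} (s : Finset ι) (M : List (A → ℝ)) (F : ι → List (A × X) → ℝ) :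
    S M (fun L => ∑ i ∈ s, F i L) = ∑ i ∈ s, S M (F i) := by
  classical
  induction s using Finset.induction_on with
  | empty => simp [S_zero]
  | insert i s hi ih => simp only [Finset.sum_insert hi, S_add, ih]

lemma S_append (M Z : List (A → ℝ)) (F : List (A × X) → ℝ) :
    S (M ++ Z) F = S M (fun L => S Z (fun K => F (L ++ K))) := by
  induction M generalizing F with
  | nil => rfl
  | cons m M ih => simp only [S, List.cons_append, ih]

lemma S_comm (M Z : List (A → ℝ)) (F : List (A × X) → List (A × X) → ℝ) :
    S M (fun L => S Z (fun K => F L K)) = S Z (fun K => S M (fun L => F L K)) := by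
  induction M generalizing F with
  | nil => rfl
  | cons m M ih =>
    simp only [S, S_sum, S_smul]
    refine Finset.sum_congr rfl fun a _ => ?_
    congr 1
    exact Finset.sum_congr rfl fun x _ => ih _

lemma S_abs_le (M : List (A → ℝ)) (hM : ∀ m ∈ M, IsLaw m) (F : List (A × X) → ℝ) :
    |S M F| ≤ S M (fun L => |F L|) := by
  rw [abs_le, ← S_neg]
  exact ⟨S_mono M hM _ _ fun L _ => neg_abs_le _, S_mono M hM _ _ fun L _ => le_abs_self _⟩

lemma S_ofFn {n : ℕ} (m : Fin n → A → ℝ) (F : List (A × X) → ℝ) :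
    S (List.ofFn m) F = ∑ y : Fin n → A × X, (∏ j, m j (y j).1) * F (List.ofFn y) := by
  induction n generalizing F with
  | zero => simp [S]
  | succ n ih =>
    rw [← (Fin.consEquiv (fun _ => A × X)).sum_comp, Fintype.sum_prod_type, Fintype.sum_prod_type]
    simp only [List.ofFn_succ, S, ih, Finset.mul_sum]
    refine Finset.sum_congr rfl fun a _ => Finset.sum_congr rfl fun x _ =>
      Finset.sum_congr rfl fun y _ => ?_
    simp [Fin.consEquiv, Fin.prod_univ_succ, mul_assoc]

/-- consistent symmetric family of finite-dimensional conditional laws -/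
structure Fam (k : ℕ) (P : List (A × X) → ℝ) : Prop where
  nonneg : ∀ L, 0 ≤ P L
  nil : P [] = 1
  perm : ∀ L L', L.Perm L' → L.length ≤ k → P L = P L'
  marg : ∀ L a, L.length < k → ∑ c, P ((a, c) :: L) = P L

variable {k : ℕ} {P : List (A × X) → ℝ}

lemma Fam.cons_le (h : Fam k P) (L : List (A × X)) (a : A) (x : X) (hL : L.length < k) :
    P ((a, x) :: L) ≤ P L := by
  rw [← h.marg L a hL]
  exact Finset.single_le_sum (f := fun c => P ((a, c) :: L)) (fun c _ => h.nonneg _) (Finset.mem_univ x)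

lemma Fam.append_le (h : Fam k P) (L K : List (A × X)) (hL : L.length + K.length ≤ k) :
    P (L ++ K) ≤ P K := by
  induction L with
  | nil => exact le_rfl
  | cons y L ih =>
    simp at hL
    refine le_trans (h.cons_le (L ++ K) y.1 y.2 (by simp; omega)) (ih (by omega))

lemma Fam.mem_le (h : Fam k P) (L K : List (A × X)) (hL : L.length + K.length ≤ k)
    (y : A × X) (hy : y ∈ L) : P (L ++ K) ≤ P (y :: K) := by
  obtain ⟨s, t, rfl⟩ := List.append_of_mem hy
  have hp : ((s ++ y :: t) ++ K).Perm ((s ++ t) ++ (y :: K)) := by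
    simp only [List.append_assoc, List.cons_append]
    refine List.Perm.append_left s ?_
    exact (List.perm_middle).symm
  rw [h.perm _ _ hp (by simp at hL ⊢; omega)]
  refine h.append_le (s ++ t) (y :: K) (by simp at hL ⊢; omega)

lemma Fam.S_marg (h : Fam k P) (M : List (A → ℝ)) (hM : ∀ m ∈ M, IsLaw m) (K : List (A × X))
    (hL : M.length + K.length ≤ k) : S M (fun L => P (L ++ K)) = P K := by
  induction M with
  | nil => rfl
  | cons m M ih =>
    simp at hL
    have hM' : ∀ m' ∈ M, IsLaw m' := fun m' h' => hM m' (by simp [h'])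
    simp only [S, List.cons_append]
    have : ∀ a, ∑ x, S M (fun L => P ((a, x) :: (L ++ K))) = P K := by
      intro a
      rw [← S_sum, ← ih hM' (by omega)]
      exact S_congr _ _ _ fun L hL' => h.marg _ a (by simp; omega)
    simp only [this, ← Finset.sum_mul, (hM m (by simp)).2, one_mul]

/-- entropy -/
noncomputable def H (P : List (A × X) → ℝ) (M : List (A → ℝ)) : ℝ :=
  - S M (fun L => P L * Real.log (P L))

/-- conditional entropy integrand -/
noncomputable def phi (P : List (A × X) → ℝ) (m : A → ℝ) (L : List (A × X)) : ℝ :=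
  ∑ a, m a * ∑ x, P ((a, x) :: L) * (Real.log (P L) - Real.log (P ((a, x) :: L)))

lemma Fam.phi_nonneg (h : Fam k P) (m : A → ℝ) (hm : IsLaw m) (L : List (A × X))
    (hL : L.length < k) : 0 ≤ phi P m L := by
  refine Finset.sum_nonneg fun a _ => mul_nonneg (hm.1 a) (Finset.sum_nonneg fun x _ => ?_)
  rcases (h.nonneg ((a, x) :: L)).eq_or_lt with h0 | h0
  · rw [← h0]; simp
  · refine mul_nonneg h0.le (sub_nonneg.2 (Real.log_le_log h0 (h.cons_le L a x hL)))

lemma log_lower (t : ℝ) (ht : 0 < t) : 1 - t⁻¹ ≤ Real.log t := Real.one_sub_inv_le_log_of_pos ht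

lemma Fam.phi_le [Nonempty X] (h : Fam k P) (m : A → ℝ) (hm : IsLaw m) (L : List (A × X))
    (hL : L.length < k) : phi P m L ≤ P L * Real.log (Fintype.card X) := by
  have hX : (0:ℝ) < Fintype.card X := by exact_mod_cast Fintype.card_pos
  have key : ∀ a, ∑ x, P ((a, x) :: L) * (Real.log (P L) - Real.log (P ((a, x) :: L)))
      ≤ P L * Real.log (Fintype.card X) := by
    intro a
    have : ∀ x, P ((a, x) :: L) * (Real.log (P L) - Real.log (P ((a, x) :: L)))
        ≤ P ((a, x) :: L) * Real.log (Fintype.card X) + (P L / Fintype.card X - P ((a, x) :: L)) := by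
      intro x
      have hle := h.cons_le L a x hL
      rcases (h.nonneg ((a, x) :: L)).eq_or_lt with h0 | h0
      · rw [← h0]; simp
        exact div_nonneg (h.nonneg _) hX.le
      · have hv : 0 < P L := lt_of_lt_of_le h0 hle
        have := Real.log_le_sub_one_of_pos (show 0 < P L / (P ((a, x) :: L) * Fintype.card X) by positivity)
        rw [Real.log_div hv.ne' (by positivity), Real.log_mul h0.ne' hX.ne'] at this
        have h2 := mul_le_mul_of_nonneg_left this h0.le
        have e : P ((a, x) :: L) * (P L / (P ((a, x) :: L) * Fintype.card X) - 1)
          = P L / Fintype.card X - P ((a, x) :: L) := by field_simp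
        rw [e] at h2
        linarith
    refine le_trans (Finset.sum_le_sum fun x _ => this x) (le_of_eq ?_)
    rw [Finset.sum_add_distrib, Finset.sum_sub_distrib, ← Finset.sum_mul, h.marg L a hL]
    simp only [Finset.sum_const, Finset.card_univ, nsmul_eq_mul]
    field_simp
    ring
  calc phi P m L ≤ ∑ a, m a * (P L * Real.log (Fintype.card X)) :=
        Finset.sum_le_sum fun a _ => mul_le_mul_of_nonneg_left (key a) (hm.1 a)
    _ = _ := by rw [← Finset.sum_mul, hm.2, one_mul]

lemma Fam.H_cons (h : Fam k P) (m : A → ℝ) (hm : IsLaw m) (M : List (A → ℝ))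
    (hL : M.length < k) : H P (m :: M) - H P M = S M (phi P m) := by
  have e : S M (fun L => P L * Real.log (P L))
      = S M (fun L => ∑ a, m a * ∑ x, P ((a, x) :: L) * Real.log (P L)) := by
    refine S_congr _ _ _ fun L hl => ?_
    simp only [← Finset.sum_mul, h.marg L _ (by omega)]
    rw [hm.2, one_mul]
  unfold H
  rw [e]
  unfold phi
  simp only [S, S_sum, S_smul, mul_sub, S_sub, Finset.sum_sub_distrib]
  ring

/-- conditioning reduces entropy, pointwise -/
lemma Fam.phi_sub (h : Fam k P) (m t : A → ℝ) (hm : IsLaw m) (ht : IsLaw t) (L : List (A × X))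
    (hL : L.length + 1 < k) : ∑ b, t b * ∑ y, phi P m ((b, y) :: L) ≤ phi P m L := by
  have key : ∀ a b, ∑ y, ∑ x, P ((a, x) :: (b, y) :: L) *
        (Real.log (P ((b, y) :: L)) - Real.log (P ((a, x) :: (b, y) :: L)))
      ≤ ∑ x, P ((a, x) :: L) * (Real.log (P L) - Real.log (P ((a, x) :: L))) := by
    intro a b
    have sw : ∀ x y, P ((a, x) :: (b, y) :: L) = P ((b, y) :: (a, x) :: L) := fun x y =>
      h.perm _ _ (List.Perm.swap _ _ _) (by simp; omega)
    have e : ∑ x, P ((a, x) :: L) * (Real.log (P L) - Real.log (P ((a, x) :: L)))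
        = ∑ y, ∑ x, P ((a, x) :: (b, y) :: L) * (Real.log (P L) - Real.log (P ((a, x) :: L))) := by
      rw [Finset.sum_comm]
      refine Finset.sum_congr rfl fun x _ => ?_
      rw [← Finset.sum_mul]
      simp only [sw]
      rw [h.marg _ b (by simp; omega)]
    rw [e]
    have pt : ∀ x y, P ((a, x) :: (b, y) :: L) *
        (Real.log (P ((b, y) :: L)) - Real.log (P ((a, x) :: (b, y) :: L)))
        ≤ P ((a, x) :: (b, y) :: L) * (Real.log (P L) - Real.log (P ((a, x) :: L)))
          + (P ((a, x) :: L) * P ((b, y) :: L) / P L - P ((a, x) :: (b, y) :: L)) := by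
      intro x y
      have h1 := h.cons_le ((b, y) :: L) a x (by simp; omega)
      have h2 := h.cons_le ((a, x) :: L) b y (by simp; omega)
      rw [← sw] at h2
      have h3 := h.cons_le L a x (by omega)
      rcases (h.nonneg ((a, x) :: (b, y) :: L)).eq_or_lt with h0 | h0
      · rw [← h0]; simp
        exact div_nonneg (mul_nonneg (h.nonneg _) (h.nonneg _)) (h.nonneg _)
      · have hs : 0 < P ((b, y) :: L) := lt_of_lt_of_le h0 h1
        have ht : 0 < P ((a, x) :: L) := lt_of_lt_of_le h0 h2
        have hv : 0 < P L := lt_of_lt_of_le ht h3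
        have := Real.log_le_sub_one_of_pos (show 0 < (P ((a, x) :: L) * P ((b, y) :: L)) / (P ((a, x) :: (b, y) :: L) * P L) by positivity)
        rw [Real.log_div (by positivity) (by positivity), Real.log_mul ht.ne' hs.ne',
          Real.log_mul h0.ne' hv.ne'] at this
        have h2 := mul_le_mul_of_nonneg_left this h0.le
        have e : P ((a, x) :: (b, y) :: L) * ((P ((a, x) :: L) * P ((b, y) :: L)) / (P ((a, x) :: (b, y) :: L) * P L) - 1)
          = P ((a, x) :: L) * P ((b, y) :: L) / P L - P ((a, x) :: (b, y) :: L) := by field_simp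
        rw [e] at h2
        linarith
    refine le_trans (Finset.sum_le_sum fun y _ => Finset.sum_le_sum fun x _ => pt x y) (le_of_eq ?_)
    simp only [Finset.sum_add_distrib, Finset.sum_sub_distrib, ← Finset.sum_div, ← Finset.sum_mul]
    have e2 : ∑ y, ∑ x, P ((a, x) :: (b, y) :: L) = P L := by
      rw [← h.marg L b (by omega)]
      exact Finset.sum_congr rfl fun y _ => h.marg _ a (by simp; omega)
    rw [e2, h.marg L a (by omega), ← Finset.mul_sum, h.marg L b (by omega)]
    have : P L * P L / P L = P L := by
      by_cases h0 : P L = 0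
      · simp [h0]
      · field_simp
    rw [this]; ring
  calc ∑ b, t b * ∑ y, phi P m ((b, y) :: L)
      = ∑ b, t b * ∑ a, m a * ∑ y, ∑ x, P ((a, x) :: (b, y) :: L) *
        (Real.log (P ((b, y) :: L)) - Real.log (P ((a, x) :: (b, y) :: L))) := by
        refine Finset.sum_congr rfl fun b _ => ?_
        congr 1
        unfold phi
        rw [Finset.sum_comm]
        refine Finset.sum_congr rfl fun a _ => ?_
        rw [Finset.mul_sum]
    _ ≤ ∑ b, t b * phi P m L :=
        Finset.sum_le_sum fun b _ => mul_le_mul_of_nonneg_left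
          (Finset.sum_le_sum fun a _ => mul_le_mul_of_nonneg_left (key a b) (hm.1 a)) (ht.1 b)
    _ = _ := by rw [← Finset.sum_mul, ht.2, one_mul]

lemma Fam.S_phi_sub (h : Fam k P) (m t : A → ℝ) (hm : IsLaw m) (ht : IsLaw t) (M : List (A → ℝ))
    (hM : ∀ m ∈ M, IsLaw m)
    (hL : M.length + 1 < k) : S (t :: M) (phi P m) ≤ S M (phi P m) := by
  have : S (t :: M) (phi P m) = S M (fun L => ∑ b, t b * ∑ y, phi P m ((b, y) :: L)) := by
    simp only [S, S_sum, S_smul]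
  rw [this]
  exact S_mono M hM _ _ fun L hl => h.phi_sub m t hm ht L (by omega)

lemma Fam.sum_phi_le (h : Fam k P) (M Z : List (A → ℝ)) (hM : ∀ m ∈ M, IsLaw m)
    (hZ : ∀ m ∈ Z, IsLaw m) (hL : M.length + Z.length < k) :
    (M.map (fun m => S (M ++ Z) (phi P m))).sum ≤ H P (M ++ Z) - H P Z := by
  induction M with
  | nil => simp
  | cons t M ih =>
    simp at hL
    have hM' : ∀ m' ∈ M, IsLaw m' := fun m' h' => hM m' (by simp [h'])
    have hMZ : ∀ m' ∈ M ++ Z, IsLaw m' := by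
      intro m' h'
      rcases List.mem_append.1 h' with h' | h'
      exacts [hM' _ h', hZ _ h']
    have ht := hM t (by simp)
    have ih := ih hM' (by omega)
    have h1 := h.S_phi_sub t t ht ht (M ++ Z) hMZ (by simp; omega)
    rw [← h.H_cons t ht (M ++ Z) (by simp; omega)] at h1
    have h2 : (M.map (fun m => S (t :: (M ++ Z)) (phi P m))).sum
       ≤ (M.map (fun m => S (M ++ Z) (phi P m))).sum :=
      List.sum_le_sum fun m hm => h.S_phi_sub m t (hM' m hm) ht (M ++ Z) hMZ (by simp; omega)
    simp only [List.map_cons, List.sum_cons, List.cons_append]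
    linarith

end
end DF
namespace DF
section
variable {X A : Type} [Fintype X] [Fintype A] {k : ℕ} {P : List (A × X) → ℝ}

lemma S_listsum {ι : Type*} (s : List ι) (M : List (A → ℝ)) (F : ι → List (A × X) → ℝ) :
    S M (fun L => (s.map (fun i => F i L)).sum) = (s.map (fun i => S M (F i))).sum := by
  induction s with
  | nil => simp [S_zero]
  | cons i s ih => simp only [List.map_cons, List.sum_cons, S_add, ih]

lemma S_prod (M : List (A → ℝ)) (hM : ∀ m ∈ M, IsLaw m) (q : A × X → ℝ)
    (hq : ∀ a, ∑ x, q (a, x) = 1) : S M (fun L => (L.map q).prod) = 1 := by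
  induction M with
  | nil => simp [S]
  | cons m M ih =>
    have hM' : ∀ m' ∈ M, IsLaw m' := fun m' h' => hM m' (by simp [h'])
    simp only [S, List.map_cons, List.prod_cons, S_smul, ih hM', mul_one, hq]
    exact (hM m (by simp)).2

lemma Fam.S_sumg (h : Fam k P) (M : List (A → ℝ)) (hM : ∀ m ∈ M, IsLaw m) (K : List (A × X))
    (hL : M.length + K.length ≤ k) (g : A × X → ℝ) :
    S M (fun L => P (L ++ K) * (L.map g).sum)
      = (M.map (fun m => ∑ a, m a * ∑ x, P ((a, x) :: K) * g (a, x))).sum := by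
  induction M with
  | nil => simp [S]
  | cons m M ih =>
    simp at hL
    have hM' : ∀ m' ∈ M, IsLaw m' := fun m' h' => hM m' (by simp [h'])
    simp only [S, List.map_cons, List.sum_cons, List.cons_append, mul_add, S_add,
      Finset.sum_add_distrib]
    congr 1
    · refine Finset.sum_congr rfl fun a _ => ?_
      congr 1
      refine Finset.sum_congr rfl fun x _ => ?_
      have : S M (fun L => P ((a, x) :: (L ++ K)) * g (a, x))
          = S M (fun L => g (a, x) * P (L ++ (a, x) :: K)) := by
        refine S_congr _ _ _ fun L hl => ?_
        rw [mul_comm, h.perm _ _ (List.perm_middle (a := (a, x)) (l₁ := L) (l₂ := K)).symm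
          (by simp; omega)]
      rw [this, S_smul, h.S_marg M hM' _ (by simp; omega), mul_comm]
    · rw [← ih hM' (by omega)]
      have : ∀ a, ∑ x, S M (fun L => P ((a, x) :: (L ++ K)) * (L.map g).sum)
          = S M (fun L => P (L ++ K) * (L.map g).sum) := by
        intro a
        rw [← S_sum]
        refine S_congr _ _ _ fun L hl => ?_
        rw [← Finset.sum_mul, h.marg _ a (by simp; omega)]
      simp only [this, ← Finset.sum_mul, (hM m (by simp)).2, one_mul]

/-- conditional single-system law -/
noncomputable def qd (P : List (A × X) → ℝ) (K : List (A × X)) (y : A × X) : ℝ :=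
  if P K = 0 then 1 / (Fintype.card X : ℝ) else P (y :: K) / P K

lemma Fam.qd_nonneg (h : Fam k P) (K : List (A × X)) (y : A × X) : 0 ≤ qd P K y := by
  unfold qd
  split_ifs
  · positivity
  · exact div_nonneg (h.nonneg _) (h.nonneg _)

lemma Fam.qd_sum [Nonempty X] (h : Fam k P) (K : List (A × X)) (hK : K.length < k) (a : A) :
    ∑ x, qd P K (a, x) = 1 := by
  unfold qd
  split_ifs with h0
  · simp
  · rw [← Finset.sum_div, h.marg K a hK, div_self h0]

lemma log_listprod {ι : Type*} (s : List ι) (f : ι → ℝ) (hf : ∀ i ∈ s, 0 < f i) :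
    0 < (s.map f).prod ∧ Real.log (s.map f).prod = (s.map (fun i => Real.log (f i))).sum := by
  induction s with
  | nil => simp
  | cons i s ih =>
    obtain ⟨h1, h2⟩ := ih (fun j hj => hf j (by simp [hj]))
    have h0 := hf i (by simp)
    simp only [List.map_cons, List.prod_cons, List.sum_cons]
    exact ⟨mul_pos h0 h1, by rw [Real.log_mul h0.ne' h1.ne', h2]⟩

/-- the de Finetti approximant, jointly with the conditioning data -/
noncomputable def V (P : List (A × X) → ℝ) (K L : List (A × X)) : ℝ :=
  P K * (L.map (qd P K)).prod

lemma Fam.V_nonneg (h : Fam k P) (K L : List (A × X)) : 0 ≤ V P K L := by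
  refine mul_nonneg (h.nonneg _) (List.prod_nonneg ?_)
  intro a ha
  obtain ⟨y, _, rfl⟩ := List.mem_map.1 ha
  exact h.qd_nonneg K y

lemma Fam.V_pos (h : Fam k P) (K L : List (A × X)) (hL : L.length + K.length ≤ k)
    (hu : 0 < P (L ++ K)) : 0 < V P K L ∧ Real.log (V P K L) = Real.log (P K) +
      (L.map (fun y => Real.log (P (y :: K)) - Real.log (P K))).sum := by
  have hK : 0 < P K := lt_of_lt_of_le hu (h.append_le L K hL)
  have hy : ∀ y ∈ L, 0 < P (y :: K) := fun y hy => lt_of_lt_of_le hu (h.mem_le L K hL y hy)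
  have hq : ∀ y ∈ L, 0 < qd P K y := by
    intro y hy'
    rw [qd, if_neg hK.ne']
    exact div_pos (hy y hy') hK
  obtain ⟨h1, h2⟩ := log_listprod L (qd P K) hq
  refine ⟨mul_pos hK h1, ?_⟩
  rw [V, Real.log_mul hK.ne' h1.ne', h2]
  congr 2
  refine List.map_congr_left fun y hy' => ?_
  rw [qd, if_neg hK.ne', Real.log_div (hy y hy').ne' hK.ne']

lemma Fam.D_eq (h : Fam k P) (M Z : List (A → ℝ)) (hM : ∀ m ∈ M, IsLaw m)
    (hL : M.length + Z.length ≤ k) :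
    S Z (fun K => S M (fun L => P (L ++ K) * Real.log (P (L ++ K))
        - P (L ++ K) * Real.log (V P K L)))
      = (M.map (fun m => S Z (phi P m))).sum - (H P (M ++ Z) - H P Z) := by
  have e : S Z (fun K => S M (fun L => P (L ++ K) * Real.log (P (L ++ K))
        - P (L ++ K) * Real.log (V P K L)))
      = S Z (fun K => S M (fun L => P (L ++ K) * Real.log (P (L ++ K)))
        - P K * Real.log (P K) + (M.map (fun m => phi P m K)).sum) := by
    refine S_congr _ _ _ fun K hK => ?_
    have e1 : S M (fun L => P (L ++ K) * Real.log (P (L ++ K)) - P (L ++ K) * Real.log (V P K L))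
        = S M (fun L => P (L ++ K) * Real.log (P (L ++ K)) - Real.log (P K) * P (L ++ K)
          - P (L ++ K) * (L.map (fun y => Real.log (P (y :: K)) - Real.log (P K))).sum) := by
      refine S_congr _ _ _ fun L hl => ?_
      rcases (h.nonneg (L ++ K)).eq_or_lt with h0 | h0
      · rw [← h0]; simp
      · rw [(h.V_pos K L (by omega) h0).2]; ring
    rw [e1, S_sub, S_sub, S_smul, h.S_marg M hM K (by omega), h.S_sumg M hM K (by omega)]
    have e2 : (M.map (fun m => ∑ a, m a * ∑ x, P ((a, x) :: K) *
        (Real.log (P ((a, x) :: K)) - Real.log (P K)))).sum = - (M.map (fun m => phi P m K)).sum := by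
      rw [List.sum_neg, List.map_map]
      congr 1
      refine List.map_congr_left fun m _ => ?_
      simp only [phi, Function.comp, ← Finset.sum_neg_distrib, ← mul_neg, neg_sub]
    rw [e2]; ring
  rw [e, S_add, S_sub, S_listsum, S_comm Z M, ← S_append M Z (fun L => P L * Real.log (P L))]
  unfold H
  ring

lemma Fam.pinsker [Nonempty X] (h : Fam k P) (M Z : List (A → ℝ)) (hM : ∀ m ∈ M, IsLaw m)
    (hZ : ∀ m ∈ Z, IsLaw m) (hL : M.length + Z.length < k) (D : ℝ) (hD0 : 0 ≤ D)
    (hD : (M.map (fun m => S Z (phi P m))).sum - (H P (M ++ Z) - H P Z) ≤ D) :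
    S M (fun L => |P L - S Z (fun K => V P K L)|) ≤ Real.sqrt (2 * D) := by
  refine sqrt_opt _ _ hD0 fun c hc => ?_
  have h1 : S M (fun L => |P L - S Z (fun K => V P K L)|)
      ≤ S M (fun L => S Z (fun K => |P (L ++ K) - V P K L|)) := by
    refine S_mono M hM _ _ fun L hl => ?_
    have : P L = S Z (fun K => P (L ++ K)) := by
      rw [← h.S_marg Z hZ L (by omega)]
      exact S_congr _ _ _ fun K hK => h.perm _ _ List.perm_append_comm (by simp; omega)
    rw [this, ← S_sub]
    exact S_abs_le Z hZ _
  have h2 : S M (fun L => S Z (fun K => |P (L ++ K) - V P K L|))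
      ≤ S Z (fun K => S M (fun L => c * ((P (L ++ K) + 2 * V P K L) / 3) + 1 / (2 * c) *
        ((P (L ++ K) * Real.log (P (L ++ K)) - P (L ++ K) * Real.log (V P K L))
          - P (L ++ K) + V P K L))) := by
    rw [S_comm]
    refine S_mono Z hZ _ _ fun K hK => S_mono M hM _ _ fun L hl => ?_
    refine pinsker_pt _ _ c (h.nonneg _) (h.V_nonneg K L) hc fun hv => ?_
    by_contra hne
    exact (h.V_pos K L (by omega) (lt_of_le_of_ne (h.nonneg _) (Ne.symm hne))).1.ne' hv
  refine le_trans h1 (le_trans h2 ?_)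
  have eV : ∀ K, K.length = Z.length → S M (fun L => V P K L) = P K := by
    intro K hK
    unfold V
    rw [S_smul, S_prod M hM _ (h.qd_sum K (by omega)), mul_one]
  have eZ : S Z P = 1 := by
    have := h.S_marg Z hZ [] (by simp; omega)
    simpa [h.nil] using this
  have e : S Z (fun K => S M (fun L => c * ((P (L ++ K) + 2 * V P K L) / 3) + 1 / (2 * c) *
        ((P (L ++ K) * Real.log (P (L ++ K)) - P (L ++ K) * Real.log (V P K L))
          - P (L ++ K) + V P K L)))
      = S Z (fun K => c * P K + 1 / (2 * c) * S M (fun L =>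
        P (L ++ K) * Real.log (P (L ++ K)) - P (L ++ K) * Real.log (V P K L))) := by
    refine S_congr _ _ _ fun K hK => ?_
    have : ∀ L, c * ((P (L ++ K) + 2 * V P K L) / 3) + 1 / (2 * c) *
        ((P (L ++ K) * Real.log (P (L ++ K)) - P (L ++ K) * Real.log (V P K L))
          - P (L ++ K) + V P K L)
        = (c / 3 - 1 / (2 * c)) * P (L ++ K) + (2 * c / 3 + 1 / (2 * c)) * V P K L
          + 1 / (2 * c) * (P (L ++ K) * Real.log (P (L ++ K)) - P (L ++ K) * Real.log (V P K L)) := by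
      intro L; ring
    simp only [this]
    rw [S_add, S_add, S_smul, S_smul, S_smul, eV K hK, h.S_marg M hM K (by omega)]
    ring
  rw [e, S_add, S_smul, S_smul, eZ, h.D_eq M Z hM (by omega), mul_one]
  have := mul_le_mul_of_nonneg_left hD (show 0 ≤ 1 / (2 * c) by positivity)
  linarith

/-- i-fold repetition of a block -/
def rep (M : List (A → ℝ)) : ℕ → List (A → ℝ)
  | 0 => []
  | i + 1 => M ++ rep M i

lemma rep_length (M : List (A → ℝ)) (i : ℕ) : (rep M i).length = i * M.length := by
  induction i with
  | zero => simp [rep]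
  | succ i ih => simp [rep, ih]; ring

lemma rep_law (M : List (A → ℝ)) (hM : ∀ m ∈ M, IsLaw m) (i : ℕ) : ∀ m ∈ rep M i, IsLaw m := by
  induction i with
  | zero => simp [rep]
  | succ i ih =>
    intro m hm
    rcases List.mem_append.1 hm with h | h
    exacts [hM _ h, ih _ h]

lemma Fam.exists_good [Nonempty X] (h : Fam k P) (M : List (A → ℝ)) (hM : ∀ m ∈ M, IsLaw m)
    (h0 : 0 < M.length) (hk : M.length < k) :
    ∃ Z : List (A → ℝ), (∀ m ∈ Z, IsLaw m) ∧ M.length + Z.length < k ∧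
      S M (fun L => |P L - S Z (fun K => V P K L)|) ≤
        Real.sqrt (2 * ((M.length : ℝ) ^ 2 * Real.log (Fintype.card X) / ((k : ℝ) - M.length))) := by
  set l := M.length with hl
  obtain ⟨n, hn⟩ : ∃ n, n = (k - 1) / l := ⟨_, rfl⟩
  have hn1 : n * l + 1 ≤ k := by
    have := Nat.div_mul_le_self (k - 1) l
    rw [← hn] at this; omega
  have hn2 : k ≤ n * l + l := by
    have := Nat.lt_div_mul_add (a := k - 1) h0
    rw [← hn] at this; omega
  have hn0 : 0 < n := by
    rcases Nat.eq_zero_or_pos n with h | h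
    · subst h; omega
    · exact h
  have hlog : 0 ≤ Real.log (Fintype.card X) := Real.log_natCast_nonneg _
  set C : ℕ → ℝ := fun i => (M.map (fun m => S (rep M i) (phi P m))).sum with hC
  have hlen : ∀ i, i ≤ n → (rep M i).length + 1 ≤ k := by
    intro i hi
    rw [rep_length, ← hl]
    have := Nat.mul_le_mul_right l hi
    omega
  have hlen' : ∀ i, i < n → l + (rep M i).length < k := by
    intro i hi
    have := hlen (i + 1) hi
    simp only [rep, List.length_append] at this
    omega
  have hsum : ∑ i ∈ Finset.range n, (C i - (H P (M ++ rep M i) - H P (rep M i)))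
      ≤ l * Real.log (Fintype.card X) := by
    calc _ ≤ ∑ i ∈ Finset.range n, (C i - C (i + 1)) := by
          refine Finset.sum_le_sum fun i hi => ?_
          have := h.sum_phi_le M (rep M i) hM (rep_law M hM i) (hlen' i (Finset.mem_range.1 hi))
          simp only [hC, rep]
          linarith
      _ = C 0 - C n := Finset.sum_range_sub' C n
      _ ≤ C 0 := by
          have : 0 ≤ C n := by
            refine List.sum_nonneg ?_
            intro a ha
            obtain ⟨m, hm, rfl⟩ := List.mem_map.1 ha
            rw [← S_zero (X := X) (rep M n)]
            refine S_mono _ (rep_law M hM n) _ _ fun L hL => h.phi_nonneg m (hM m hm) L ?_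
            have := hlen n le_rfl
            omega
          linarith
      _ ≤ l * Real.log (Fintype.card X) := by
          have : C 0 ≤ (M.map (fun _ => Real.log (Fintype.card X))).sum := by
            refine List.sum_le_sum fun m hm => ?_
            simp only [rep, S]
            have := h.phi_le m (hM m hm) [] (by simp; omega)
            rwa [h.nil, one_mul] at this
          simpa using this
  obtain ⟨i, hi, hle⟩ : ∃ i ∈ Finset.range n, (C i - (H P (M ++ rep M i) - H P (rep M i)))
      ≤ l * Real.log (Fintype.card X) / n := by
    refine Finset.exists_le_of_sum_le ⟨0, Finset.mem_range.2 hn0⟩ (le_trans hsum (le_of_eq ?_))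
    have : (n : ℝ) ≠ 0 := by positivity
    simp only [Finset.sum_const, Finset.card_range, nsmul_eq_mul]
    field_simp
  have hi := Finset.mem_range.1 hi
  have hkl : (0:ℝ) < (k : ℝ) - l := by
    have : (l : ℝ) < k := by exact_mod_cast hk
    linarith
  refine ⟨rep M i, rep_law M hM i, hlen' i hi, ?_⟩
  refine h.pinsker M (rep M i) hM (rep_law M hM i) (hlen' i hi) _ (by positivity) (le_trans hle ?_)
  have hn' : (0:ℝ) < n := by exact_mod_cast hn0
  rw [div_le_div_iff₀ hn' hkl]
  have h2 : (k : ℝ) - l ≤ n * l := by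
    have : (k : ℝ) ≤ n * l + l := by exact_mod_cast hn2
    linarith
  have := mul_le_mul_of_nonneg_left h2 (show 0 ≤ l * Real.log (Fintype.card X) by positivity)
  nlinarith

end
end DF
namespace DF
section
variable {X A : Type} [Fintype X] {k : ℕ}

/-- evaluate p on a list of (input, output) pairs -/
def base (y0 : A × X) (p : (Fin k → X) → (Fin k → A) → ℝ) (L : List (A × X)) : ℝ :=
  p (fun i => (L.getD i y0).2) (fun i => (L.getD i y0).1)

/-- sum out d further systems -/
def R (y0 : A × X) (p : (Fin k → X) → (Fin k → A) → ℝ) : ℕ → List (A × X) → ℝ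
  | 0, L => base y0 p L
  | d + 1, L => ∑ c, R y0 p d ((y0.1, c) :: L)

variable (y0 : A × X) (p : (Fin k → X) → (Fin k → A) → ℝ)

lemma base_swap (hsym : ∀ (π : Equiv.Perm (Fin k)) (xv : Fin k → X) (av : Fin k → A),
      p (xv ∘ π) (av ∘ π) = p xv av) (pre t : List (A × X)) (a b : A × X)
    (hL : pre.length + 2 + t.length = k) :
    base y0 p (pre ++ a :: b :: t) = base y0 p (pre ++ b :: a :: t) := by
  have h1 : pre.length < k := by omega
  have h2 : pre.length + 1 < k := by omega
  have key : ∀ i : Fin k, (pre ++ a :: b :: t).getD i y0 =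
      (pre ++ b :: a :: t).getD (Equiv.swap (⟨pre.length, h1⟩ : Fin k) ⟨pre.length + 1, h2⟩ i) y0 := by
    intro i
    by_cases e1 : i = ⟨pre.length, h1⟩
    · subst e1
      rw [Equiv.swap_apply_left]
      simp [List.getD_eq_getElem?_getD]
    by_cases e2 : i = ⟨pre.length + 1, h2⟩
    · subst e2
      rw [Equiv.swap_apply_right]
      simp [List.getD_eq_getElem?_getD]
    rw [Equiv.swap_apply_of_ne_of_ne e1 e2]
    have e1' : (i : ℕ) ≠ pre.length := fun h => e1 (Fin.ext h)
    have e2' : (i : ℕ) ≠ pre.length + 1 := fun h => e2 (Fin.ext h)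
    simp only [List.getD_eq_getElem?_getD]
    rcases lt_or_ge (i : ℕ) pre.length with h | h
    · rw [List.getElem?_append_left h, List.getElem?_append_left h]
    · rw [List.getElem?_append_right h, List.getElem?_append_right h]
      obtain ⟨r, hr⟩ : ∃ r, (i : ℕ) - pre.length = r + 2 := ⟨i - pre.length - 2, by omega⟩
      rw [hr]; simp
  rw [base, base, ← hsym (Equiv.swap (⟨pre.length, h1⟩ : Fin k) ⟨pre.length + 1, h2⟩)]
  congr 1
  · funext i; simp only [Function.comp, key, Equiv.swap_apply_self]
  · funext i; simp only [Function.comp, key, Equiv.swap_apply_self]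

lemma base_perm (hsym : ∀ (π : Equiv.Perm (Fin k)) (xv : Fin k → X) (av : Fin k → A),
      p (xv ∘ π) (av ∘ π) = p xv av) (L L' : List (A × X)) (h : L.Perm L') (hL : L.length = k) :
    base y0 p L = base y0 p L' := by
  have : ∀ pre : List (A × X), pre.length + L.length = k →
      base y0 p (pre ++ L) = base y0 p (pre ++ L') := by
    clear hL
    induction h with
    | nil => intro pre _; rfl
    | cons x _ ih =>
      intro pre hp
      have := ih (pre ++ [x]) (by simp at hp ⊢; omega)
      simpa using this
    | swap x y l =>
      intro pre hp
      exact base_swap y0 p hsym pre l y x (by simp at hp; omega)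
    | trans h1 h2 ih1 ih2 =>
      intro pre hp
      rw [ih1 pre hp, ih2 pre (by rw [← h1.length_eq]; exact hp)]
  simpa using this [] (by simpa using hL)

lemma R_perm (hsym : ∀ (π : Equiv.Perm (Fin k)) (xv : Fin k → X) (av : Fin k → A),
      p (xv ∘ π) (av ∘ π) = p xv av) (d : ℕ) (L L' : List (A × X)) (h : L.Perm L')
      (hL : L.length + d = k) :
    R y0 p d L = R y0 p d L' := by
  induction d generalizing L L' with
  | zero => exact base_perm y0 p hsym L L' h hL
  | succ d ih =>
    simp only [R]
    exact Finset.sum_congr rfl fun c _ => ih _ _ (h.cons _) (by simp; omega)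

lemma R_ns (hns : IsNonSignalingK p)
    (hsym : ∀ (π : Equiv.Perm (Fin k)) (xv : Fin k → X) (av : Fin k → A),
      p (xv ∘ π) (av ∘ π) = p xv av) (d : ℕ) (L : List (A × X)) (a a' : A)
      (hL : L.length + 1 + d = k) :
    ∑ c, R y0 p d ((a, c) :: L) = ∑ c, R y0 p d ((a', c) :: L) := by
  induction d generalizing L with
  | zero =>
    have hk : 0 < k := by omega
    have key : ∀ (b : A) (c : X), base y0 p ((b, c) :: L) =
        p (Function.update (fun i : Fin k => (((a, y0.2) :: L).getD i y0).2) ⟨0, hk⟩ c)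
          (Function.update (fun i : Fin k => (((a, y0.2) :: L).getD i y0).1) ⟨0, hk⟩ b) := by
      intro b c
      unfold base
      congr 1
      · funext i
        by_cases h : i = ⟨0, hk⟩
        · subst h; simp
        · rw [Function.update_of_ne h]
          obtain ⟨r, hr⟩ : ∃ r, (i : ℕ) = r + 1 :=
            ⟨i - 1, by have : (i : ℕ) ≠ 0 := fun h' => h (Fin.ext h'); omega⟩
          simp [hr]
      · funext i
        by_cases h : i = ⟨0, hk⟩
        · subst h; simp
        · rw [Function.update_of_ne h]
          obtain ⟨r, hr⟩ : ∃ r, (i : ℕ) = r + 1 :=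
            ⟨i - 1, by have : (i : ℕ) ≠ 0 := fun h' => h (Fin.ext h'); omega⟩
          simp [hr]
    simp only [R, key]
    rw [hns _ _ _ a']
    simp
  | succ d ih =>
    have : ∀ b, ∑ c, R y0 p (d + 1) ((b, c) :: L)
        = ∑ c', ∑ c, R y0 p d ((b, c) :: (y0.1, c') :: L) := by
      intro b
      simp only [R]
      rw [Finset.sum_comm]
      refine Finset.sum_congr rfl fun c _ => Finset.sum_congr rfl fun c' _ => ?_
      exact R_perm y0 p hsym d _ _ (List.Perm.swap _ _ _) (by simp; omega)
    rw [this, this]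
    exact Finset.sum_congr rfl fun c' _ => ih _ (by simp; omega)

lemma R_eq_sum (hns : IsNonSignalingK p)
    (hsym : ∀ (π : Equiv.Perm (Fin k)) (xv : Fin k → X) (av : Fin k → A),
      p (xv ∘ π) (av ∘ π) = p xv av) (d : ℕ) (e : Fin d → A) (L : List (A × X))
      (hL : L.length + d = k) :
    R y0 p d L = ∑ h : Fin d → X, base y0 p (L ++ List.ofFn (fun i => (e i, h i))) := by
  induction d generalizing L with
  | zero => simp [R]
  | succ d ih =>
    simp only [R]
    rw [R_ns y0 p hns hsym d L y0.1 (e 0) (by omega),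
      ← (Fin.consEquiv (fun _ => X)).sum_comp, Fintype.sum_prod_type]
    refine Finset.sum_congr rfl fun c _ => ?_
    rw [ih (fun i => e i.succ) _ (by simp; omega)]
    refine Finset.sum_congr rfl fun h _ => ?_
    refine base_perm y0 p hsym _ _ ?_ (by simp; omega)
    simp only [List.ofFn_succ, List.cons_append]
    exact List.perm_middle.symm

/-- the family of marginals -/
def PP (L : List (A × X)) : ℝ := R y0 p (k - L.length) L

lemma PP_fam (hp0 : ∀ xv av, 0 ≤ p xv av) (hp1 : ∀ av, (∑ xv : Fin k → X, p xv av) = 1)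
    (hns : IsNonSignalingK p)
    (hsym : ∀ (π : Equiv.Perm (Fin k)) (xv : Fin k → X) (av : Fin k → A),
      p (xv ∘ π) (av ∘ π) = p xv av) : Fam k (PP y0 p) where
  nonneg := by
    have : ∀ d L, 0 ≤ R y0 p d L := by
      intro d
      induction d with
      | zero => intro L; exact hp0 _ _
      | succ d ih => intro L; exact Finset.sum_nonneg fun c _ => ih _
    intro L; exact this _ _
  nil := by
    simp only [PP, List.length_nil, Nat.sub_zero]
    rw [R_eq_sum y0 p hns hsym k (fun _ => y0.1) [] (by simp), ← hp1 (fun _ => y0.1)]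
    refine Finset.sum_congr rfl fun h _ => ?_
    simp [base, List.getD_eq_getElem?_getD]
  perm := by
    intro L L' h hL
    rw [PP, PP, ← h.length_eq]
    exact R_perm y0 p hsym _ L L' h (by omega)
  marg := by
    intro L a hL
    simp only [PP, List.length_cons]
    rw [R_ns y0 p hns hsym _ L a y0.1 (by omega)]
    obtain ⟨d, hd⟩ : ∃ d, k - L.length = d + 1 := ⟨k - L.length - 1, by omega⟩
    rw [show k - (L.length + 1) = d by omega, hd]
    simp only [R]

lemma margFirst_eq (hns : IsNonSignalingK p)
    (hsym : ∀ (π : Equiv.Perm (Fin k)) (xv : Fin k → X) (av : Fin k → A),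
      p (xv ∘ π) (av ∘ π) = p xv av) {l : ℕ} (hlk : l ≤ k) (ext : Fin k → A) (f : Fin l → A)
      (xv : Fin l → X) :
    margFirst hlk p (overrideFirst ext f) xv = PP y0 p (List.ofFn (fun j => (f j, xv j))) := by
  let E : Fin (k - l) ≃ {i : Fin k // ¬ (i : ℕ) < l} :=
    { toFun := fun i => ⟨⟨l + i, by omega⟩, by simp⟩
      invFun := fun i => ⟨i.1 - l, by have := i.1.2; have := i.2; omega⟩
      left_inv := fun i => by simp
      right_inv := fun i => by
        apply Subtype.ext; apply Fin.ext
        have := i.2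
        simp; omega }
  have hd : k - (List.ofFn (fun j => (f j, xv j))).length = k - l := by simp
  rw [PP, hd, R_eq_sum y0 p hns hsym (k - l) (fun i => ext ⟨l + i, by omega⟩) _ (by simp; omega)]
  unfold margFirst
  rw [← (E.arrowCongr (Equiv.refl X)).sum_comp]
  refine Finset.sum_congr rfl fun h _ => ?_
  unfold base
  have key : ∀ i : Fin k, (List.ofFn (fun j => (f j, xv j)) ++
      List.ofFn (fun i : Fin (k - l) => (ext ⟨l + i, by omega⟩, h i))).getD i y0
      = (overrideFirst ext f i, if hi : (i : ℕ) < l then xv ⟨i, hi⟩ else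
        h ⟨i - l, by omega⟩) := by
    intro i
    rw [List.getD_eq_getElem?_getD, overrideFirst]
    by_cases hi : (i : ℕ) < l
    · rw [List.getElem?_append_left (by simpa using hi)]
      simp [hi]
    · rw [List.getElem?_append_right (by simpa using hi)]
      have h3 : (i : ℕ) - l < k - l := by omega
      have h4 : l + ((i : ℕ) - l) = i := by omega
      simp [hi, h3, h4]
  simp only [key]
  congr 1

end

lemma exists_nonempty {X A : Type} [Fintype X] [Nonempty A] {k : ℕ} (hk : 0 < k)
    (p : (Fin k → X) → (Fin k → A) → ℝ)
    (hp1 : ∀ av, (∑ xv : Fin k → X, p xv av) = 1) : Nonempty X := by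
  by_contra hX
  rw [not_nonempty_iff] at hX
  have : IsEmpty (Fin k → X) := ⟨fun f => hX.elim (f ⟨0, hk⟩)⟩
  have := hp1 (fun _ => Classical.arbitrary A)
  simp at this

end DF

theorem multipartite_nonsignaling_deFinetti
    {X A : Type} [Fintype X] [Fintype A] [Nonempty A] [DecidableEq X] [DecidableEq A]
    {k l : ℕ} (hl : 0 < l) (hlk : l < k)
    (p : (Fin k → X) → (Fin k → A) → ℝ)
    (hp0 : ∀ xv av, 0 ≤ p xv av) (hp1 : ∀ av, (∑ xv : Fin k → X, p xv av) = 1)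
    (hns : IsNonSignalingK p)
    (hsym : ∀ (π : Equiv.Perm (Fin k)) (xv : Fin k → X) (av : Fin k → A),
      p (xv ∘ π) (av ∘ π) = p xv av)
    (μ : Fin k → A → ℝ) (hμ0 : ∀ j a, 0 ≤ μ j a) (hμ1 : ∀ j, (∑ a, μ j a) = 1) :
    ∃ (N : ℕ) (w : Fin N → ℝ) (q : Fin N → A → X → ℝ),
      (∀ i, 0 ≤ w i) ∧ (∑ i, w i) = 1 ∧
      (∀ i a x, 0 ≤ q i a x) ∧ (∀ i a, (∑ x, q i a x) = 1) ∧
      ∀ ext : Fin k → A,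
        (∑ f : Fin l → A, (∏ j : Fin l, μ (Fin.castLE hlk.le j) (f j)) *
          (∑ xv : Fin l → X,
            |margFirst hlk.le p (overrideFirst ext f) xv -
              ∑ i, w i * ∏ j : Fin l, q i (f j) (xv j)|)) ≤
        Real.sqrt (2 * (l : ℝ) ^ 2 * Real.log (Fintype.card X) / ((k : ℝ) - l)) := by
  have hX : Nonempty X := DF.exists_nonempty (by omega) p hp1
  obtain ⟨x0⟩ := id hX
  obtain ⟨a0⟩ := ‹Nonempty A›
  have hF := DF.PP_fam (a0, x0) p hp0 hp1 hns hsym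
  set P := DF.PP (a0, x0) p with hP
  set M : List (A → ℝ) := List.ofFn (fun j : Fin l => μ (Fin.castLE hlk.le j)) with hMdef
  have hMl : M.length = l := by simp [hMdef]
  have hM : ∀ m ∈ M, DF.IsLaw m := by
    intro m hm
    obtain ⟨j, rfl⟩ := (List.mem_ofFn' _ _).1 hm
    exact ⟨hμ0 _, hμ1 _⟩
  obtain ⟨Z, hZ, hZk, hle⟩ := hF.exists_good M hM (by omega) (by omega)
  rw [hMl] at hle hZk
  let I := Fin Z.length → A × X
  let w : I → ℝ := fun y => (∏ j, Z.get j (y j).1) * P (List.ofFn y)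
  have hSZ : ∀ F : List (A × X) → ℝ, DF.S Z F
      = ∑ y : I, (∏ j, Z.get j (y j).1) * F (List.ofFn y) := by
    intro F
    rw [← DF.S_ofFn, List.ofFn_get]
  let e := Fintype.equivFin I
  refine ⟨Fintype.card I, fun i => w (e.symm i),
    fun i a x => DF.qd P (List.ofFn (e.symm i)) (a, x), ?_, ?_, ?_, ?_, ?_⟩
  · intro i
    exact mul_nonneg (Finset.prod_nonneg fun j _ => (hZ _ (List.get_mem _ _)).1 _) (hF.nonneg _)
  · rw [e.symm.sum_comp w, ← hSZ]
    have := hF.S_marg Z hZ [] (by simp; omega)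
    simpa [hF.nil] using this
  · intro i a x
    exact hF.qd_nonneg _ _
  · intro i a
    exact hF.qd_sum _ (by simp; omega) a
  · intro ext
    refine le_trans (le_of_eq ?_) (le_trans hle (le_of_eq ?_))
    · rw [hMdef, DF.S_ofFn, ← (Equiv.arrowProdEquivProdArrow (Fin l) (fun _ => A) (fun _ => X)).symm.sum_comp,
        Fintype.sum_prod_type]
      refine Finset.sum_congr rfl fun f _ => ?_
      rw [Finset.mul_sum]
      refine Finset.sum_congr rfl fun xv _ => ?_
      rw [DF.margFirst_eq (a0, x0) p hns hsym hlk.le ext f xv, hSZ]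
      have hs : ∑ i, w (e.symm i) * ∏ j : Fin l, DF.qd P (List.ofFn (e.symm i)) (f j, xv j)
          = ∑ y : I, (∏ j, Z.get j (y j).1) *
            DF.V P (List.ofFn y) (List.ofFn (fun j => (f j, xv j))) := by
        rw [e.symm.sum_comp (fun y => w y * ∏ j : Fin l, DF.qd P (List.ofFn y) (f j, xv j))]
        refine Finset.sum_congr rfl fun y _ => ?_
        simp only [w, DF.V, List.map_ofFn, List.prod_ofFn, Function.comp, mul_assoc]
      rw [hs]
      rfl
    · congr 1
      ring
end

section
/- Let G(2, π, V) be a two-player one-round free game with π = π_R × π_Q a product distribution on R × Q and payoff V on A × B × R × Q (first player's answers in A). Define the (m+1)-player game Ḡ as follows: the verifier samples r ∼ π_R, q ∼ π_Q and j ∈ [m] uniformly at random, sends r to player 0 and q to player j (the remaining players receive a fixed dummy question and their answers are ignored), and the payoff is V(a₀, a_j | r, q), where a₀ ∈ A is player 0's answer and a_j ∈ B is player j's answer. Then ω_c(G) = ω_c(Ḡ) ≤ ω_e(Ḡ) ≤ ω_ns(Ḡ) ≤ ω_c(G) + √( ln|A| / (2m) ). -/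
/- From a two-player free game G(2, π_R × π_Q, V) build the (m+1)-player game Ḡ in which a
   question r ∼ π_R goes to player 0, a question q ∼ π_Q goes to a uniformly random player
   j ∈ [m] (the remaining players get a dummy question and their answers are ignored) and the
   payoff is V(a₀, a_j | r, q). Then
   ω_c(G) = ω_c(Ḡ) ≤ ω_e(Ḡ) ≤ ω_ns(Ḡ) ≤ ω_c(G) + √(ln|A|/(2m)). -/

open scoped BigOperators ComplexOrder

noncomputable section

variable {R Q A B : Type}

/-- The question vector of the modified game in which player j receives q and every other
    player receives the dummy question `none`. -/
def dummyQ {Q : Type} [DecidableEq Q] (m : ℕ) (j : Fin m) (q : Q) : Fin m → Option Q :=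
  Function.update (fun _ => (none : Option Q)) j (some q)

/-- The question distribution π̄ of the modified game Ḡ. -/
noncomputable def piBar [Fintype Q] [DecidableEq Q] {m : ℕ}
    (πR : R → ℝ) (πQ : Q → ℝ) (r : R) (qv : Fin m → Option Q) : ℝ :=
  πR r * (1 / m) * ∑ j : Fin m, ∑ q : Q, if qv = dummyQ m j q then πQ q else 0

/-- The payoff V̄ of the modified game Ḡ. -/
noncomputable def VBar [Fintype Q] [DecidableEq Q] {m : ℕ}
    (V : A → B → R → Q → ℝ) (a : A) (bv : Fin m → B) (r : R) (qv : Fin m → Option Q) : ℝ :=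
  ∑ j : Fin m, ∑ q : Q, if qv = dummyQ m j q then V a (bv j) r q else 0

/-- The classical value of the original two-player free game G. -/
noncomputable def cValueG [Fintype R] [Fintype Q]
    (πR : R → ℝ) (πQ : Q → ℝ) (V : A → B → R → Q → ℝ) : ℝ :=
  sSup {v : ℝ | ∃ (fa : R → A) (fb : Q → B),
    v = ∑ r, ∑ q, πR r * πQ q * V (fa r) (fb q) r q}

/-- The classical value of the modified game Ḡ. -/
noncomputable def cValueGBar [Fintype R] [Fintype Q] [DecidableEq Q] [Fintype B] {m : ℕ}
    (πR : R → ℝ) (πQ : Q → ℝ) (V : A → B → R → Q → ℝ) : ℝ :=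
  sSup {v : ℝ | ∃ (fa : R → A) (fb : Fin m → Option Q → B),
    v = ∑ r, ∑ qv : Fin m → Option Q,
      piBar πR πQ r qv * VBar V (fa r) (fun j => fb j (qv j)) r qv}

/-- The non-signaling value of the modified game Ḡ. -/
noncomputable def nsValueGBar [Fintype R] [Fintype Q] [DecidableEq Q]
    [Fintype A] [Fintype B] {m : ℕ}
    (πR : R → ℝ) (πQ : Q → ℝ) (V : A → B → R → Q → ℝ) : ℝ :=
  sSup {v : ℝ | ∃ p : A → (Fin m → B) → R → (Fin m → Option Q) → ℝ,
    (∀ a bv r qv, 0 ≤ p a bv r qv) ∧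
    (∀ r qv, (∑ a, ∑ bv : Fin m → B, p a bv r qv) = 1) ∧
    (∀ (bv : Fin m → B) (r r' : R) (qv : Fin m → Option Q),
      (∑ a, p a bv r qv) = ∑ a, p a bv r' qv) ∧
    (∀ (j : Fin m) (a : A) (bv : Fin m → B) (r : R) (qv : Fin m → Option Q)
        (x : Option Q),
      (∑ c : B, p a (Function.update bv j c) r qv) =
        ∑ c : B, p a (Function.update bv j c) r (Function.update qv j x)) ∧
    v = ∑ r, ∑ qv : Fin m → Option Q, piBar πR πQ r qv *
      ∑ a, ∑ bv : Fin m → B, VBar V a bv r qv * p a bv r qv}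

/-- The entangled value of the modified game Ḡ. -/
noncomputable def entValueGBar [Fintype R] [Fintype Q] [DecidableEq Q]
    [Fintype A] [Fintype B] {m : ℕ}
    (πR : R → ℝ) (πQ : Q → ℝ) (V : A → B → R → Q → ℝ) : ℝ :=
  sSup {v : ℝ |
    ∃ (d0 : ℕ) (d : Fin m → ℕ) (ψ : (Fin d0 × ∀ j, Fin (d j)) → ℂ)
      (M0 : R → A → Matrix (Fin d0) (Fin d0) ℂ)
      (M : ∀ j, Option Q → B → Matrix (Fin (d j)) (Fin (d j)) ℂ),
      (∑ t : Fin d0 × ∀ j, Fin (d j), Complex.normSq (ψ t)) = 1 ∧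
      (∀ r a, (M0 r a).PosSemidef) ∧ (∀ r, (∑ a, M0 r a) = 1) ∧
      (∀ j oq b, (M j oq b).PosSemidef) ∧ (∀ j oq, (∑ b, M j oq b) = 1) ∧
      v = (∑ r, ∑ qv : Fin m → Option Q, (piBar πR πQ r qv : ℂ) *
            ∑ a, ∑ bv : Fin m → B, (VBar V a bv r qv : ℂ) *
              ∑ s : Fin d0 × ∀ j, Fin (d j), ∑ t : Fin d0 × ∀ j, Fin (d j),
                (starRingEnd ℂ) (ψ s) * (M0 r a s.1 t.1 *
                  ∏ j, M j (qv j) (bv j) (s.2 j) (t.2 j)) * ψ t).re}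


lemma hoeff_fin {ι : Type} [Fintype ι] (w f : ι → ℝ) (hw : ∀ i, 0 ≤ w i) (hw1 : ∑ i, w i = 1)
    (hf : ∀ i, f i ∈ Set.Icc (0:ℝ) 1) (l : ℝ) :
    ∑ i, w i * Real.exp (l * (f i - ∑ j, w j * f j)) ≤ Real.exp (l ^ 2 / 8) := by
  let : MeasurableSpace ι := ⊤
  have : MeasurableSingletonClass ι := ⟨fun _ => trivial⟩
  have h1 : ∑ i, ENNReal.ofReal (w i) = 1 := by
    rw [← ENNReal.ofReal_sum_of_nonneg (fun i _ => hw i), hw1, ENNReal.ofReal_one]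
  let P : PMF ι := PMF.ofFintype (fun i => ENNReal.ofReal (w i)) h1
  have hInteg : ∀ g : ι → ℝ, ∫ i, g i ∂P.toMeasure = ∑ i, w i * g i := by
    intro g
    rw [PMF.integral_eq_sum]
    refine Finset.sum_congr rfl fun i _ => ?_
    simp [P, PMF.ofFintype_apply, ENNReal.toReal_ofReal (hw i)]
  have h := ProbabilityTheory.hasSubgaussianMGF_of_mem_Icc (μ := P.toMeasure) (X := f) (a := 0)
    (b := 1) (measurable_from_top.aemeasurable) (Filter.Eventually.of_forall hf)
  have h2 := h.mgf_le l
  rw [ProbabilityTheory.mgf, hInteg, hInteg] at h2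
  refine h2.trans (le_of_eq ?_)
  congr 1
  simp
  ring

/-- mutual information bound, unnormalised. -/
lemma step_ineq {A B : Type} [Fintype A] [Fintype B] (x f : A → B → ℝ) (hx : ∀ a b, 0 ≤ x a b)
    (hf : ∀ a b, f a b ∈ Set.Icc (0:ℝ) 1) (al : A → ℝ) (be : B → ℝ) (M : ℝ)
    (hal : ∀ a, ∑ b, x a b = al a) (hbe : ∀ b, ∑ a, x a b = be b) (hM : ∑ a, al a = M)
    (l : ℝ) (hl : 0 < l) :
    ∑ a, ∑ b, f a b * x a b ≤ (∑ a, ∑ b, f a b * (al a * be b)) / M + M * (l / 8) +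
      (1 / l) * ((∑ a, Real.negMulLog (al a) - Real.negMulLog M) -
        ∑ b, (∑ a, Real.negMulLog (x a b) - Real.negMulLog (be b))) := by
  have hal0 : ∀ a, 0 ≤ al a := fun a => hal a ▸ Finset.sum_nonneg fun b _ => hx a b
  have hbe0 : ∀ b, 0 ≤ be b := fun b => hbe b ▸ Finset.sum_nonneg fun a _ => hx a b
  have hxal : ∀ a b, x a b ≤ al a := fun a b => hal a ▸
    Finset.single_le_sum (f := fun b => x a b) (fun b _ => hx a b) (Finset.mem_univ b)
  have hxbe : ∀ a b, x a b ≤ be b := fun a b => hbe b ▸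
    Finset.single_le_sum (f := fun a => x a b) (fun a _ => hx a b) (Finset.mem_univ a)
  have halM : ∀ a, al a ≤ M := fun a => hM ▸
    Finset.single_le_sum (f := al) (fun b _ => hal0 b) (Finset.mem_univ a)
  have hM0 : 0 ≤ M := hM ▸ Finset.sum_nonneg fun a _ => hal0 a
  have hbeM : ∑ b, be b = M := by
    rw [← hM]; simp_rw [← hal, ← hbe]; exact Finset.sum_comm
  have hsx : ∑ a, ∑ b, x a b = M := by rw [← hM]; simp_rw [hal]
  rcases hM0.eq_or_lt with h0 | hMpos
  · have e1 : ∀ a, al a = 0 := fun a => le_antisymm (h0 ▸ halM a) (hal0 a)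
    have e2 : ∀ a b, x a b = 0 := fun a b => le_antisymm (e1 a ▸ hxal a b) (hx a b)
    have e3 : ∀ b, be b = 0 := fun b => by rw [← hbe]; simp [e2]
    simp [e1, e2, e3, ← h0]
  -- the information as a single sum
  have hI : ((∑ a, Real.negMulLog (al a) - Real.negMulLog M) -
        ∑ b, (∑ a, Real.negMulLog (x a b) - Real.negMulLog (be b))) =
      ∑ a, ∑ b, x a b * (Real.log (x a b) + Real.log M - Real.log (al a) - Real.log (be b)) := by
    simp only [mul_sub, mul_add, Finset.sum_sub_distrib, Finset.sum_add_distrib]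
    have t1 : ∑ a, ∑ b, x a b * Real.log M = - Real.negMulLog M := by
      simp_rw [← Finset.sum_mul, hsx, Real.negMulLog]; ring
    have t2 : ∑ a, ∑ b, x a b * Real.log (al a) = - ∑ a, Real.negMulLog (al a) := by
      simp_rw [← Finset.sum_mul, hal, Real.negMulLog]; simp
    have t3 : ∑ a, ∑ b, x a b * Real.log (be b) = - ∑ b, Real.negMulLog (be b) := by
      rw [Finset.sum_comm]
      simp_rw [← Finset.sum_mul, hbe, Real.negMulLog]; simp
    have t4 : ∑ a, ∑ b, x a b * Real.log (x a b) = - ∑ b, ∑ a, Real.negMulLog (x a b) := by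
      rw [Finset.sum_comm]
      simp_rw [Real.negMulLog]; simp
    rw [t1, t2, t3, t4]; ring
  rw [hI]
  set I := ∑ a, ∑ b, x a b * (Real.log (x a b) + Real.log M - Real.log (al a) - Real.log (be b))
  set S := ∑ a, ∑ b, f a b * (al a * be b) with hS
  set c := S / M / M + l / 8 with hc
  have hpt : ∀ a b, x a b - al a * be b / M * Real.exp (l * (f a b - c)) ≤
      x a b * (Real.log (x a b) + Real.log M - Real.log (al a) - Real.log (be b)) -
        l * (f a b * x a b - c * x a b) := by
    intro a b
    rcases (hx a b).eq_or_lt with h | h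
    · rw [← h]
      have : 0 ≤ al a * be b / M * Real.exp (l * (f a b - c)) := by
        have := hal0 a; have := hbe0 b; positivity
      simp only [zero_mul, mul_zero, sub_zero]; linarith
    · have ha : 0 < al a := h.trans_le (hxal a b)
      have hb : 0 < be b := h.trans_le (hxbe a b)
      set z := al a * be b / M * Real.exp (l * (f a b - c)) with hz
      have hz0 : 0 < z := by positivity
      have hlz : Real.log z = Real.log (al a) + Real.log (be b) - Real.log M + l * (f a b - c) := by
        rw [hz, Real.log_mul (by positivity) (by positivity), Real.log_exp,
          Real.log_div (by positivity) (by positivity), Real.log_mul (by positivity) (by positivity)]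
      have h1 := Real.log_le_sub_one_of_pos (div_pos hz0 h)
      rw [Real.log_div hz0.ne' h.ne', hlz] at h1
      have h2 := mul_le_mul_of_nonneg_left h1 h.le
      have h3 : x a b * (z / x a b - 1) = z - x a b := by field_simp
      rw [h3] at h2
      linarith
  have hsum := Finset.sum_le_sum fun a (_ : a ∈ Finset.univ) =>
    Finset.sum_le_sum fun b (_ : b ∈ Finset.univ) => hpt a b
  simp only [Finset.sum_sub_distrib, ← Finset.mul_sum] at hsum
  rw [hsx] at hsum
  have hH := hoeff_fin (ι := A × B) (fun i => al i.1 * be i.2 / M / M) (fun i => f i.1 i.2)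
    (fun i => by have := hal0 i.1; have := hbe0 i.2; positivity)
    (by
      rw [Fintype.sum_prod_type]
      simp only [← Finset.sum_div, ← Finset.mul_sum, ← Finset.sum_mul, hbeM, hM]
      field_simp) (fun i => hf _ _) l
  have hmean : ∑ j : A × B, al j.1 * be j.2 / M / M * f j.1 j.2 = S / M / M := by
    rw [hS, Fintype.sum_prod_type]
    simp only [Finset.sum_div]
    refine Finset.sum_congr rfl fun a _ => Finset.sum_congr rfl fun b _ => by ring
  rw [hmean, Fintype.sum_prod_type] at hH
  have hexp : ∑ a, ∑ b, al a * be b / M * Real.exp (l * (f a b - c)) ≤ M := by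
    have : ∀ a b, al a * be b / M * Real.exp (l * (f a b - c)) =
        M * Real.exp (-(l ^ 2 / 8)) * (al a * be b / M / M * Real.exp (l * (f a b - S / M / M))) := by
      intro a b
      have : l * (f a b - c) = -(l ^ 2 / 8) + l * (f a b - S / M / M) := by rw [hc]; ring
      rw [this, Real.exp_add]; field_simp
    simp only [this, ← Finset.mul_sum]
    calc _ ≤ M * Real.exp (-(l ^ 2 / 8)) * Real.exp (l ^ 2 / 8) :=
          mul_le_mul_of_nonneg_left hH (by positivity)
      _ = M := by rw [mul_assoc, ← Real.exp_add]; simp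
  have hfin : l * (∑ a, ∑ b, f a b * x a b - c * M) ≤ I := by linarith
  have h5 : ∑ a, ∑ b, f a b * x a b - c * M ≤ 1 / l * I := by
    rw [one_div, inv_mul_eq_div, le_div_iff₀ hl]; linarith
  have h6 : c * M = S / M + M * (l / 8) := by rw [hc]; field_simp
  linarith

lemma sum_update_eq {m : ℕ} [Fintype B] [DecidableEq B] (g : (Fin m → B) → ℝ) (j : Fin m) :
    ∑ bv, ∑ c, g (Function.update bv j c) = Fintype.card B * ∑ bv, g bv := by
  have h1 : ∑ x : (Fin m → B) × B, g (Function.update x.1 j x.2) =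
      ∑ x : (Fin m → B) × B, g x.1 := by
    refine Finset.sum_nbij' (fun x => (Function.update x.1 j x.2, x.1 j))
      (fun x => (Function.update x.1 j x.2, x.1 j)) ?_ ?_ ?_ ?_ ?_ <;> simp
  rw [Fintype.sum_prod_type, Fintype.sum_prod_type] at h1
  rw [h1]
  simp [Finset.mul_sum]

lemma sum_indep {m : ℕ} [Fintype B] [DecidableEq B] [Nonempty B] (g g' : (Fin m → B) → ℝ)
    (j : Fin m)
    (h : ∀ bv, ∑ c, g (Function.update bv j c) = ∑ c, g' (Function.update bv j c)) :
    ∑ bv, g bv = ∑ bv, g' bv := by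
  have h1 := sum_update_eq g j
  rw [Finset.sum_congr rfl fun bv _ => h bv, sum_update_eq g' j] at h1
  have : (Fintype.card B : ℝ) ≠ 0 := by exact_mod_cast Fintype.card_ne_zero
  exact (mul_left_cancel₀ this h1).symm

lemma const_of_update {X : Type} {m : ℕ} (F : (Fin m → X) → ℝ)
    (h : ∀ qv j x, F qv = F (Function.update qv j x)) (q q' : Fin m → X) : F q = F q' := by
  have key : ∀ s : Finset (Fin m), F (s.piecewise q' q) = F q := by
    intro s
    induction s using Finset.induction_on with
    | empty => simp
    | insert j s _ ih => rw [Finset.piecewise_insert, ← h, ih]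
  have := key Finset.univ
  rw [Finset.piecewise_univ] at this
  exact this.symm

/-- (Unnormalised) non-signaling boxes. -/
structure IsNS [Fintype A] [Fintype B] {m : ℕ}
    (p : A → (Fin m → B) → R → (Fin m → Option Q) → ℝ) : Prop where
  nn : ∀ a bv r qv, 0 ≤ p a bv r qv
  sigA : ∀ (bv : Fin m → B) (r r' : R) (qv : Fin m → Option Q),
      (∑ a, p a bv r qv) = ∑ a, p a bv r' qv
  sigB : ∀ (j : Fin m) (a : A) (bv : Fin m → B) (r : R) (qv : Fin m → Option Q)
        (x : Option Q),
      (∑ c : B, p a (Function.update bv j c) r qv) =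
        ∑ c : B, p a (Function.update bv j c) r (Function.update qv j x)

lemma IsNS.margA [Fintype A] [Fintype B] [DecidableEq B] [Nonempty B] {m : ℕ}
    {p : A → (Fin m → B) → R → (Fin m → Option Q) → ℝ} (h : IsNS p) (a : A) (r : R)
    (qv qv' : Fin m → Option Q) : ∑ bv, p a bv r qv = ∑ bv, p a bv r qv' :=
  const_of_update (fun qv => ∑ bv, p a bv r qv)
    (fun qv j x => sum_indep _ _ j fun bv => h.sigB j a bv r qv x) qv qv'

lemma IsNS.mass [Fintype A] [Fintype B] [DecidableEq B] [Nonempty B] {m : ℕ}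
    {p : A → (Fin m → B) → R → (Fin m → Option Q) → ℝ} (h : IsNS p) (r r' : R)
    (qv qv' : Fin m → Option Q) : ∑ a, ∑ bv, p a bv r qv = ∑ a, ∑ bv, p a bv r' qv' := by
  rw [Finset.sum_congr rfl fun a _ => h.margA a r qv qv', Finset.sum_comm,
    Finset.sum_congr rfl fun bv _ => h.sigA bv r r' qv', Finset.sum_comm]

lemma IsNS.sub [Fintype A] [Fintype B] {m : ℕ}
    {p : A → (Fin (m + 1) → B) → R → (Fin (m + 1) → Option Q) → ℝ} (h : IsNS p)
    (b : B) (oq : Option Q) :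
    IsNS (fun (a : A) (bv : Fin m → B) (r : R) (qv : Fin m → Option Q) =>
      p a (Fin.cons b bv) r (Fin.cons oq qv)) where
  nn a bv r qv := h.nn _ _ _ _
  sigA bv r r' qv := h.sigA _ _ _ _
  sigB j a bv r qv x := by
    simp only [Fin.cons_update]
    exact h.sigB j.succ a _ r _ x

lemma sum_cons_fun {m : ℕ} [Fintype B] (g : (Fin (m + 1) → B) → ℝ) :
    ∑ bv, g bv = ∑ b, ∑ bv : Fin m → B, g (Fin.cons b bv) := by
  rw [← (Fin.consEquiv (fun _ : Fin (m + 1) => B)).sum_comp, Fintype.sum_prod_type]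
  rfl

lemma IsNS.sum_head [Fintype A] [Fintype B] [Nonempty B] {m : ℕ}
    {p : A → (Fin (m + 1) → B) → R → (Fin (m + 1) → Option Q) → ℝ} (h : IsNS p)
    (a : A) (bv : Fin m → B) (r : R) (x y : Option Q) (qv : Fin m → Option Q) :
    ∑ b, p a (Fin.cons b bv) r (Fin.cons x qv) = ∑ b, p a (Fin.cons b bv) r (Fin.cons y qv) := by
  have := h.sigB 0 a (Fin.cons (Classical.arbitrary B) bv) r (Fin.cons x qv) y
  simpa only [Fin.update_cons_zero] using this

lemma dummyQ_zero [DecidableEq Q] (m : ℕ) (q : Q) :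
    dummyQ (m + 1) 0 q = Fin.cons (some q) (fun _ => none) := by
  funext i
  refine Fin.cases ?_ (fun i => ?_) i <;> simp [dummyQ]

lemma dummyQ_succ [DecidableEq Q] (m : ℕ) (j : Fin m) (q : Q) :
    dummyQ (m + 1) j.succ q = Fin.cons none (dummyQ m j q) := by
  rw [dummyQ, dummyQ, Fin.cons_update]
  congr 1
  funext i
  refine Fin.cases ?_ (fun i => ?_) i <;> simp

lemma prod_bound [Fintype R] [Fintype Q] [Fintype A] [Fintype B] [Nonempty A] [Nonempty B]
    (πR : R → ℝ) (hπR0 : ∀ r, 0 ≤ πR r) (πQ : Q → ℝ) (hπQ0 : ∀ q, 0 ≤ πQ q)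
    (V : A → B → R → Q → ℝ) (w : ℝ)
    (hw : ∀ (fa : R → A) (fb : Q → B), ∑ r, ∑ q, πR r * πQ q * V (fa r) (fb q) r q ≤ w)
    (al : R → A → ℝ) (be : Q → B → ℝ) (M : ℝ) (hM : 0 ≤ M)
    (hal0 : ∀ r a, 0 ≤ al r a) (hbe0 : ∀ q b, 0 ≤ be q b)
    (hal : ∀ r, ∑ a, al r a = M) (hbe : ∀ q, ∑ b, be q b = M) :
    ∑ r, πR r * ∑ q, πQ q * ∑ a, ∑ b, V a b r q * (al r a * be q b) ≤ w * M * M := by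
  choose fa hfa using fun r => Finite.exists_max
    (fun a => ∑ q, πQ q * ∑ b, V a b r q * be q b)
  choose fb hfb using fun q => Finite.exists_max
    (fun b => ∑ r, πR r * V (fa r) b r q)
  calc ∑ r, πR r * ∑ q, πQ q * ∑ a, ∑ b, V a b r q * (al r a * be q b)
      = ∑ r, πR r * ∑ a, al r a * ∑ q, πQ q * ∑ b, V a b r q * be q b := by
        refine Finset.sum_congr rfl fun r _ => ?_
        congr 1
        simp only [Finset.mul_sum]
        rw [Finset.sum_comm]
        refine Finset.sum_congr rfl fun a _ => Finset.sum_congr rfl fun q _ =>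
          Finset.sum_congr rfl fun b _ => by ring
    _ ≤ ∑ r, πR r * ∑ a, al r a * ∑ q, πQ q * ∑ b, V (fa r) b r q * be q b := by
        exact Finset.sum_le_sum fun r _ => mul_le_mul_of_nonneg_left
          (Finset.sum_le_sum fun a _ => mul_le_mul_of_nonneg_left (hfa r a) (hal0 r a)) (hπR0 r)
    _ = M * ∑ q, πQ q * ∑ b, be q b * ∑ r, πR r * V (fa r) b r q := by
        simp only [← Finset.sum_mul, hal]
        simp only [Finset.mul_sum]
        rw [Finset.sum_comm]
        refine Finset.sum_congr rfl fun q _ => ?_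
        rw [Finset.sum_comm]
        refine Finset.sum_congr rfl fun a _ => Finset.sum_congr rfl fun q _ => by ring
    _ ≤ M * ∑ q, πQ q * ∑ b, be q b * ∑ r, πR r * V (fa r) (fb q) r q := by
        exact mul_le_mul_of_nonneg_left (Finset.sum_le_sum fun q _ => mul_le_mul_of_nonneg_left
          (Finset.sum_le_sum fun b _ => mul_le_mul_of_nonneg_left (hfb q b) (hbe0 q b)) (hπQ0 q)) hM
    _ = M * M * ∑ r, ∑ q, πR r * πQ q * V (fa r) (fb q) r q := by
        simp only [← Finset.sum_mul, hbe]
        simp only [Finset.mul_sum]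
        rw [Finset.sum_comm]
        refine Finset.sum_congr rfl fun a _ => Finset.sum_congr rfl fun q _ => by ring
    _ ≤ M * M * w := mul_le_mul_of_nonneg_left (hw fa fb) (by positivity)
    _ = _ := by ring

lemma avg_sub [Fintype Q] (πQ : Q → ℝ) (hπQ1 : (∑ q, πQ q) = 1) (c : ℝ) (G : Q → ℝ) :
    ∑ q, πQ q * (c - G q) = c - ∑ q, πQ q * G q := by
  simp only [mul_sub, Finset.sum_sub_distrib]
  rw [← Finset.sum_mul, hπQ1, one_mul]

lemma avg_tail [Fintype R] [Fintype Q] (πR : R → ℝ) (πQ : Q → ℝ) (hπQ1 : (∑ q, πQ q) = 1)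
    (G : R → Q → ℝ) (c k : ℝ) :
    ∑ q, πQ q * (c + k * ∑ r, πR r * G r q) = c + k * ∑ r, πR r * ∑ q, πQ q * G r q := by
  simp only [mul_add, Finset.sum_add_distrib]
  rw [← Finset.sum_mul, hπQ1, one_mul]
  congr 1
  simp only [Finset.mul_sum]
  rw [Finset.sum_comm]
  exact Finset.sum_congr rfl fun r _ => Finset.sum_congr rfl fun q _ => by ring

lemma avg_expand [Fintype R] [Fintype Q] (πR : R → ℝ) (hπR1 : (∑ r, πR r) = 1)
    (πQ : Q → ℝ) (hπQ1 : (∑ q, πQ q) = 1) (F G : R → Q → ℝ) (M c k : ℝ) :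
    ∑ r, πR r * ∑ q, πQ q * (F r q / M + c + k * G r q) =
      (∑ r, πR r * ∑ q, πQ q * F r q) / M + c + k * ∑ r, πR r * ∑ q, πQ q * G r q := by
  have h1 : ∀ r, ∑ q, πQ q * (F r q / M + c + k * G r q) =
      (∑ q, πQ q * F r q) / M + c + k * ∑ q, πQ q * G r q := by
    intro r
    simp only [mul_add, Finset.sum_add_distrib]
    rw [← Finset.sum_mul, hπQ1, one_mul, Finset.sum_div, Finset.mul_sum]
    congr 1
    · congr 1
      exact Finset.sum_congr rfl fun q _ => by ring
    · exact Finset.sum_congr rfl fun q _ => by ring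
  simp only [h1]
  simp only [mul_add, Finset.sum_add_distrib]
  rw [← Finset.sum_mul, hπR1, one_mul, Finset.sum_div, Finset.mul_sum]
  congr 1
  · congr 1
    exact Finset.sum_congr rfl fun q _ => by ring
  · exact Finset.sum_congr rfl fun q _ => by ring

lemma ns_induct [Fintype R] [Fintype Q] [DecidableEq Q] [Fintype A] [DecidableEq A]
    [Fintype B] [DecidableEq B] [Nonempty A] [Nonempty B]
    (πR : R → ℝ) (hπR0 : ∀ r, 0 ≤ πR r) (hπR1 : (∑ r, πR r) = 1)
    (πQ : Q → ℝ) (hπQ0 : ∀ q, 0 ≤ πQ q) (hπQ1 : (∑ q, πQ q) = 1)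
    (V : A → B → R → Q → ℝ) (hV : ∀ a b r q, V a b r q ∈ Set.Icc (0 : ℝ) 1) (w : ℝ)
    (hw : ∀ (fa : R → A) (fb : Q → B), ∑ r, ∑ q, πR r * πQ q * V (fa r) (fb q) r q ≤ w)
    (l : ℝ) (hl : 0 < l) (m : ℕ) :
    ∀ (p : A → (Fin m → B) → R → (Fin m → Option Q) → ℝ) (M : ℝ), IsNS p →
      (∀ r qv, ∑ a, ∑ bv, p a bv r qv = M) →
      ∑ j : Fin m, ∑ r, πR r * ∑ q, πQ q * ∑ a, ∑ bv : Fin m → B,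
        V a (bv j) r q * p a bv r (dummyQ m j q) ≤
      m * ((w + l / 8) * M) + (1 / l) * ∑ r, πR r *
        (∑ a, Real.negMulLog (∑ bv, p a bv r (fun _ => none)) - Real.negMulLog M) := by
  obtain ⟨r0⟩ : Nonempty R := by
    by_contra h
    rw [not_nonempty_iff] at h
    simp at hπR1
  induction m with
  | zero =>
    intro p M hp hmass
    have : 0 ≤ ∑ r, πR r *
        (∑ a, Real.negMulLog (∑ bv, p a bv r (fun _ => none)) - Real.negMulLog M) := by
      refine Finset.sum_nonneg fun r _ => mul_nonneg (hπR0 r) ?_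
      have h1 := hmass r (fun _ => none)
      set al := fun a => ∑ bv, p a bv r (fun _ => none) with hal
      have hal0 : ∀ a, 0 ≤ al a := fun a => Finset.sum_nonneg fun bv _ => hp.nn _ _ _ _
      change ∑ a, al a = M at h1
      have h2 : Real.negMulLog M = ∑ a, -(al a * Real.log M) := by
        rw [Finset.sum_neg_distrib, ← Finset.sum_mul, h1, Real.negMulLog]; ring
      rw [h2, ← Finset.sum_sub_distrib]
      refine Finset.sum_nonneg fun a _ => ?_
      change 0 ≤ Real.negMulLog (al a) - _
      rw [Real.negMulLog]
      rcases (hal0 a).eq_or_lt with h | h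
      · rw [← h]; simp
      · have h3 : al a ≤ M := h1 ▸
          Finset.single_le_sum (f := al) (fun b _ => hal0 b) (Finset.mem_univ a)
        have := mul_le_mul_of_nonneg_left (Real.log_le_log h h3) h.le
        linarith
    have h2 : 0 ≤ 1 / l := by positivity
    simpa using mul_nonneg h2 this
  | succ m ih =>
    intro p M hp hmass
    have hM0 : 0 ≤ M := by
      rw [← hmass r0 (fun _ => none)]
      exact Finset.sum_nonneg fun a _ => Finset.sum_nonneg fun bv _ => hp.nn _ _ _ _
    -- marginals
    set be : Q → B → ℝ := fun q b =>
      ∑ a, ∑ bv : Fin m → B, p a (Fin.cons b bv) r0 (Fin.cons (some q) (fun _ => none)) with hbe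
    have hbe' : ∀ q b r qv, ∑ a, ∑ bv : Fin m → B,
        p a (Fin.cons b bv) r (Fin.cons (some q) qv) = be q b := fun q b r qv =>
      (hp.sub b (some q)).mass r r0 qv (fun _ => none)
    set x : R → Q → A → B → ℝ := fun r q a b =>
      ∑ bv : Fin m → B, p a (Fin.cons b bv) r (Fin.cons (some q) (fun _ => none)) with hx
    set al : R → A → ℝ := fun r a => ∑ bv, p a bv r (fun _ => none) with hal
    have hx0 : ∀ r q a b, 0 ≤ x r q a b := fun r q a b =>
      Finset.sum_nonneg fun bv _ => hp.nn _ _ _ _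
    have hxal : ∀ r q a, ∑ b, x r q a b = al r a := by
      intro r q a
      rw [hal]
      dsimp only
      rw [hp.margA a r (fun _ => none) (Fin.cons (some q) (fun _ => none)), sum_cons_fun]
    have hxbe : ∀ r q b, ∑ a, x r q a b = be q b := fun r q b => hbe' q b r _
    have halM : ∀ r, ∑ a, al r a = M := fun r => hmass r _
    have hbeM : ∀ q, ∑ b, be q b = M := by
      intro q
      rw [← halM r0]
      simp_rw [← hxal r0 q, ← hxbe r0 q]
      exact Finset.sum_comm
    -- head player
    have hhead : ∑ r, πR r * ∑ q, πQ q * ∑ a, ∑ bv : Fin (m + 1) → B,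
        V a (bv 0) r q * p a bv r (dummyQ (m + 1) 0 q) ≤
        (w + l / 8) * M + (1 / l) * ∑ r, πR r * ∑ q, πQ q *
          ((∑ a, Real.negMulLog (al r a) - Real.negMulLog M) -
            ∑ b, (∑ a, Real.negMulLog (x r q a b) - Real.negMulLog (be q b))) := by
      have e1 : ∀ r q, ∑ a, ∑ bv : Fin (m + 1) → B,
          V a (bv 0) r q * p a bv r (dummyQ (m + 1) 0 q) =
          ∑ a, ∑ b, V a b r q * x r q a b := by
        intro r q
        refine Finset.sum_congr rfl fun a _ => ?_
        rw [sum_cons_fun]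
        simp only [Fin.cons_zero, dummyQ_zero, ← Finset.mul_sum, hx]
      have e2 : ∀ r q, _ := fun r q => step_ineq (x r q) (fun a b => V a b r q) (hx0 r q)
        (fun a b => hV a b r q) (al r) (be q) M (hxal r q) (hxbe r q) (halM r) l hl
      have e3 := prod_bound πR hπR0 πQ hπQ0 V w hw al be M hM0
        (fun r a => Finset.sum_nonneg fun bv _ => hp.nn _ _ _ _)
        (fun q b => Finset.sum_nonneg fun a _ => Finset.sum_nonneg fun bv _ => hp.nn _ _ _ _)
        halM hbeM
      have e4 : (∑ r, πR r * ∑ q, πQ q * ∑ a, ∑ b, V a b r q * (al r a * be q b)) / M ≤ w * M := by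
        rcases hM0.eq_or_lt with h | h
        · rw [← h]; simp
        · rw [div_le_iff₀ h]; exact e3
      simp only [e1]
      calc _ ≤ ∑ r, πR r * ∑ q, πQ q * ((∑ a, ∑ b, V a b r q * (al r a * be q b)) / M +
            M * (l / 8) + (1 / l) * ((∑ a, Real.negMulLog (al r a) - Real.negMulLog M) -
            ∑ b, (∑ a, Real.negMulLog (x r q a b) - Real.negMulLog (be q b)))) := by
            gcongr with r _ q _
            · exact hπR0 r
            · exact hπQ0 q
            · exact e2 r q
        _ = (∑ r, πR r * ∑ q, πQ q * ∑ a, ∑ b, V a b r q * (al r a * be q b)) / M +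
            M * (l / 8) + (1 / l) * ∑ r, πR r * ∑ q, πQ q *
            ((∑ a, Real.negMulLog (al r a) - Real.negMulLog M) -
            ∑ b, (∑ a, Real.negMulLog (x r q a b) - Real.negMulLog (be q b))) := by
            exact avg_expand πR hπR1 πQ hπQ1
              (fun r q => ∑ a, ∑ b, V a b r q * (al r a * be q b)) _ M (M * (l / 8)) (1 / l)
        _ ≤ _ := by linarith
    -- tail players
    have htail : ∀ q0 : Q, ∑ j : Fin m, ∑ r, πR r * ∑ q, πQ q * ∑ a, ∑ bv : Fin (m + 1) → B,
        V a (bv j.succ) r q * p a bv r (dummyQ (m + 1) j.succ q) ≤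
        m * ((w + l / 8) * M) + (1 / l) * ∑ r, πR r * 
          ∑ b, (∑ a, Real.negMulLog (x r q0 a b) - Real.negMulLog (be q0 b)) := by
      intro q0
      have e1 : ∀ (j : Fin m) r q, ∑ a, ∑ bv : Fin (m + 1) → B,
        V a (bv j.succ) r q * p a bv r (dummyQ (m + 1) j.succ q) = 
        ∑ b, ∑ a, ∑ bv : Fin m → B, V a (bv j) r q *
          p a (Fin.cons b bv) r (Fin.cons (some q0) (dummyQ m j q)) := by
        intro j r q
        rw [Finset.sum_comm (s := (Finset.univ : Finset B))]
        refine Finset.sum_congr rfl fun a _ => ?_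
        rw [sum_cons_fun, Finset.sum_comm, Finset.sum_comm (s := (Finset.univ : Finset B))]
        refine Finset.sum_congr rfl fun bv _ => ?_
        simp only [Fin.cons_succ, dummyQ_succ, ← Finset.mul_sum]
        rw [hp.sum_head a bv r none (some q0)]
      have e2 := Finset.sum_le_sum fun b (_ : b ∈ Finset.univ) =>
        ih _ (be q0 b) (hp.sub b (some q0)) (hbe' q0 b)
      simp only [e1]
      refine le_trans (le_of_eq ?_) (e2.trans (le_of_eq ?_))
      · rw [Finset.sum_comm (s := (Finset.univ : Finset B))]
        refine Finset.sum_congr rfl fun j _ => ?_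
        rw [Finset.sum_comm (s := (Finset.univ : Finset B))]
        refine Finset.sum_congr rfl fun r _ => ?_
        rw [← Finset.mul_sum]
        congr 1
        rw [Finset.sum_comm (s := (Finset.univ : Finset B))]
        refine Finset.sum_congr rfl fun q _ => ?_
        rw [← Finset.mul_sum]
      · rw [Finset.sum_add_distrib, ← Finset.mul_sum, ← Finset.mul_sum, hbeM, ← Finset.mul_sum,
          Finset.sum_comm]
        simp only [← Finset.mul_sum, hx]
    have htail' : ∑ j : Fin m, ∑ r, πR r * ∑ q, πQ q * ∑ a, ∑ bv : Fin (m + 1) → B,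
        V a (bv j.succ) r q * p a bv r (dummyQ (m + 1) j.succ q) ≤
        m * ((w + l / 8) * M) + (1 / l) * ∑ r, πR r * ∑ q, πQ q *
          ∑ b, (∑ a, Real.negMulLog (x r q a b) - Real.negMulLog (be q b)) := by
      have := Finset.sum_le_sum fun q (_ : q ∈ Finset.univ) =>
        mul_le_mul_of_nonneg_left (htail q) (hπQ0 q)
      rw [← Finset.sum_mul, hπQ1, one_mul] at this
      refine this.trans (le_of_eq ?_)
      exact avg_tail πR πQ hπQ1 (fun r q => ∑ b, (∑ a, Real.negMulLog (x r q a b) -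
        Real.negMulLog (be q b))) _ _
    rw [Fin.sum_univ_succ]
    refine (add_le_add hhead htail').trans (le_of_eq ?_)
    have : ∑ r, πR r * ∑ q, πQ q *
          ((∑ a, Real.negMulLog (al r a) - Real.negMulLog M) -
            ∑ b, (∑ a, Real.negMulLog (x r q a b) - Real.negMulLog (be q b))) =
        ∑ r, πR r * (∑ a, Real.negMulLog (al r a) - Real.negMulLog M) -
        ∑ r, πR r * ∑ q, πQ q *
          ∑ b, (∑ a, Real.negMulLog (x r q a b) - Real.negMulLog (be q b)) := by
      rw [← Finset.sum_sub_distrib]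
      refine Finset.sum_congr rfl fun r _ => ?_
      rw [← mul_sub]
      congr 1
      exact avg_sub πQ hπQ1 _ _
    rw [this]
    push_cast
    ring

/-- Expectation of a tensor product of operators. -/
def evT {m d0 : ℕ} {d : Fin m → ℕ} (ψ : (Fin d0 × ∀ j, Fin (d j)) → ℂ)
    (K0 : Matrix (Fin d0) (Fin d0) ℂ) (K : ∀ j, Matrix (Fin (d j)) (Fin (d j)) ℂ) : ℂ :=
  ∑ s : Fin d0 × ∀ j, Fin (d j), ∑ t : Fin d0 × ∀ j, Fin (d j),
    (starRingEnd ℂ) (ψ s) * (K0 s.1 t.1 * ∏ j, K j (s.2 j) (t.2 j)) * ψ t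

lemma psd_entries {n : ℕ} {M : Matrix (Fin n) (Fin n) ℂ} (h : M.PosSemidef) :
    ∃ (k : ℕ) (v : Fin k → Fin n → ℂ), ∀ s t, M s t = ∑ i, v i s * (starRingEnd ℂ) (v i t) := by
  obtain ⟨k, v, hv⟩ := Matrix.posSemidef_iff_eq_sum_vecMulVec.mp h
  refine ⟨k, v, fun s t => ?_⟩
  rw [hv, Matrix.sum_apply]
  rfl

lemma evT_nonneg {m d0 : ℕ} {d : Fin m → ℕ} (ψ : (Fin d0 × ∀ j, Fin (d j)) → ℂ)
    (K0 : Matrix (Fin d0) (Fin d0) ℂ) (K : ∀ j, Matrix (Fin (d j)) (Fin (d j)) ℂ)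
    (h0 : K0.PosSemidef) (h : ∀ j, (K j).PosSemidef) : 0 ≤ (evT ψ K0 K).re := by
  obtain ⟨k0, v0, hv0⟩ := psd_entries h0
  choose k v hv using fun j => psd_entries (h j)
  let u : (Fin k0 × ∀ j, Fin (k j)) → (Fin d0 × ∀ j, Fin (d j)) → ℂ :=
    fun i s => v0 i.1 s.1 * ∏ j, v j (i.2 j) (s.2 j)
  have hT : ∀ s t : Fin d0 × ∀ j, Fin (d j), K0 s.1 t.1 * ∏ j, K j (s.2 j) (t.2 j) =
      ∑ i, u i s * (starRingEnd ℂ) (u i t) := by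
    intro s t
    rw [hv0]
    simp only [hv]
    rw [Fintype.prod_sum, Finset.sum_mul_sum, Fintype.sum_prod_type]
    refine Finset.sum_congr rfl fun i _ => Finset.sum_congr rfl fun i' _ => ?_
    simp only [u, map_mul, map_prod, Finset.prod_mul_distrib]
    ring
  have hE : evT ψ K0 K = ∑ i, (∑ s, (starRingEnd ℂ) (ψ s) * u i s) *
      (starRingEnd ℂ) (∑ s, (starRingEnd ℂ) (ψ s) * u i s) := by
    rw [evT]
    simp only [hT, map_sum, map_mul, Complex.conj_conj, Finset.sum_mul_sum]
    rw [Finset.sum_comm (s := (Finset.univ : Finset (Fin k0 × ∀ j, Fin (k j))))]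
    refine Finset.sum_congr rfl fun s _ => ?_
    rw [Finset.sum_comm (s := (Finset.univ : Finset (Fin k0 × ∀ j, Fin (k j))))]
    refine Finset.sum_congr rfl fun t _ => ?_
    rw [Finset.mul_sum, Finset.sum_mul]
    refine Finset.sum_congr rfl fun i _ => by ring
  rw [hE, Complex.re_sum]
  refine Finset.sum_nonneg fun i _ => ?_
  rw [Complex.mul_conj, Complex.ofReal_re]
  exact Complex.normSq_nonneg _

lemma evT_sum0 {m d0 : ℕ} {d : Fin m → ℕ} [Fintype A] (ψ : (Fin d0 × ∀ j, Fin (d j)) → ℂ)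
    (K0 : A → Matrix (Fin d0) (Fin d0) ℂ) (K : ∀ j, Matrix (Fin (d j)) (Fin (d j)) ℂ) :
    ∑ a, evT ψ (K0 a) K = evT ψ (∑ a, K0 a) K := by
  simp only [evT]
  rw [Finset.sum_comm]
  refine Finset.sum_congr rfl fun s _ => ?_
  rw [Finset.sum_comm]
  refine Finset.sum_congr rfl fun t _ => ?_
  rw [Matrix.sum_apply, Finset.sum_mul, Finset.mul_sum, Finset.sum_mul]

lemma evT_sum_slot {m d0 : ℕ} {d : Fin m → ℕ} [Fintype B] (ψ : (Fin d0 × ∀ j, Fin (d j)) → ℂ)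
    (K0 : Matrix (Fin d0) (Fin d0) ℂ) (K : ∀ j, Matrix (Fin (d j)) (Fin (d j)) ℂ) (j : Fin m)
    (N : B → Matrix (Fin (d j)) (Fin (d j)) ℂ) :
    ∑ c, evT ψ K0 (Function.update K j (N c)) = evT ψ K0 (Function.update K j (∑ c, N c)) := by
  have hp : ∀ (X : Matrix (Fin (d j)) (Fin (d j)) ℂ) (s t : ∀ j, Fin (d j)),
      ∏ i, Function.update K j X i (s i) (t i) =
        X (s j) (t j) * ∏ i ∈ Finset.univ.erase j, K i (s i) (t i) := by
    intro X s t
    rw [← Finset.mul_prod_erase _ _ (Finset.mem_univ j), Function.update_self]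
    congr 1
    refine Finset.prod_congr rfl fun i hi => ?_
    rw [Function.update_of_ne (Finset.ne_of_mem_erase hi)]
  simp only [evT, hp]
  rw [Finset.sum_comm]
  refine Finset.sum_congr rfl fun s _ => ?_
  rw [Finset.sum_comm]
  refine Finset.sum_congr rfl fun t _ => ?_
  rw [Matrix.sum_apply, Finset.sum_mul, Finset.mul_sum, Finset.mul_sum, Finset.sum_mul]

lemma evT_sum_all {m d0 : ℕ} {d : Fin m → ℕ} [Fintype B] (ψ : (Fin d0 × ∀ j, Fin (d j)) → ℂ)
    (K0 : Matrix (Fin d0) (Fin d0) ℂ) (N : ∀ j, B → Matrix (Fin (d j)) (Fin (d j)) ℂ) :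
    ∑ bv : Fin m → B, evT ψ K0 (fun j => N j (bv j)) = evT ψ K0 (fun j => ∑ b, N j b) := by
  simp only [evT]
  rw [Finset.sum_comm]
  refine Finset.sum_congr rfl fun s _ => ?_
  rw [Finset.sum_comm]
  refine Finset.sum_congr rfl fun t _ => ?_
  simp only [Matrix.sum_apply]
  rw [Fintype.prod_sum, Finset.mul_sum, Finset.mul_sum, Finset.sum_mul]

lemma evT_one {m d0 : ℕ} {d : Fin m → ℕ} (ψ : (Fin d0 × ∀ j, Fin (d j)) → ℂ) :
    evT ψ 1 (fun _ => 1) = ((∑ t, Complex.normSq (ψ t) : ℝ) : ℂ) := by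
  rw [evT, Complex.ofReal_sum]
  refine Finset.sum_congr rfl fun s _ => ?_
  rw [Finset.sum_eq_single s]
  · simp [Complex.normSq_eq_conj_mul_self]
  · intro t _ hts
    have : (1 : Matrix (Fin d0) (Fin d0) ℂ) s.1 t.1 *
        ∏ j, (1 : Matrix (Fin (d j)) (Fin (d j)) ℂ) (s.2 j) (t.2 j) = 0 := by
      by_contra hne
      rw [mul_eq_zero, not_or, ← ne_eq (∏ j, _), Finset.prod_ne_zero_iff] at hne
      apply hts
      refine Prod.ext ?_ (funext fun j => ?_)
      · by_contra h
        exact hne.1 (Matrix.one_apply_ne fun h' => h h'.symm)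
      · by_contra h
        exact hne.2 j (Finset.mem_univ j) (Matrix.one_apply_ne fun h' => h h'.symm)
    rw [this]; simp
  · simp

lemma dummyQ_inj [DecidableEq Q] {m : ℕ} {j j' : Fin m} {q q' : Q}
    (h : dummyQ m j q = dummyQ m j' q') : j' = j ∧ q' = q := by
  have h1 := congrFun h j
  simp only [dummyQ, Function.update_self] at h1
  by_cases hj : j = j'
  · subst hj
    simp at h1
    exact ⟨rfl, h1.symm⟩
  · simp [Function.update_of_ne hj] at h1

lemma VBar_dummy [Fintype Q] [DecidableEq Q] {m : ℕ} (V : A → B → R → Q → ℝ) (a : A)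
    (bv : Fin m → B) (r : R) (j : Fin m) (q : Q) :
    VBar V a bv r (dummyQ m j q) = V a (bv j) r q := by
  rw [VBar, Finset.sum_eq_single j, Finset.sum_eq_single q]
  · simp
  · intro q' _ hq
    rw [if_neg fun h => hq (dummyQ_inj h).2]
  · simp
  · intro j' _ hj
    refine Finset.sum_eq_zero fun q' _ => ?_
    rw [if_neg fun h => hj (dummyQ_inj h).1]
  · simp

lemma piBar_sum [Fintype Q] [DecidableEq Q] {m : ℕ} (πR : R → ℝ) (πQ : Q → ℝ) (r : R)
    (F : (Fin m → Option Q) → ℝ) :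
    ∑ qv, piBar πR πQ r qv * F qv =
      πR r * (1 / m) * ∑ j : Fin m, ∑ q, πQ q * F (dummyQ m j q) := by
  simp only [piBar, mul_assoc, ← Finset.mul_sum, Finset.sum_mul]
  congr 2
  rw [Finset.sum_comm]
  refine Finset.sum_congr rfl fun j _ => ?_
  rw [Finset.sum_comm]
  refine Finset.sum_congr rfl fun q _ => ?_
  simp [ite_mul]

lemma cBar_val [Fintype R] [Fintype Q] [DecidableEq Q] {m : ℕ} (πR : R → ℝ) (πQ : Q → ℝ)
    (V : A → B → R → Q → ℝ) (fa : R → A) (fb : Fin m → Option Q → B) :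
    ∑ r, ∑ qv : Fin m → Option Q,
      piBar πR πQ r qv * VBar V (fa r) (fun j => fb j (qv j)) r qv =
    (1 / m) * ∑ j, ∑ r, ∑ q, πR r * πQ q * V (fa r) (fb j (some q)) r q := by
  have : ∀ r, _ := fun r => piBar_sum (m := m) πR πQ r
    (fun qv => VBar V (fa r) (fun j => fb j (qv j)) r qv)
  simp only [this, VBar_dummy]
  rw [Finset.sum_comm (s := (Finset.univ : Finset (Fin m))), Finset.mul_sum]
  refine Finset.sum_congr rfl fun r _ => ?_
  simp only [Finset.mul_sum]
  refine Finset.sum_congr rfl fun j _ => Finset.sum_congr rfl fun q _ => ?_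
  simp only [dummyQ, Function.update_self]
  ring

lemma nsBar_val [Fintype R] [Fintype Q] [DecidableEq Q] [Fintype A] [Fintype B] {m : ℕ}
    (πR : R → ℝ) (πQ : Q → ℝ) (V : A → B → R → Q → ℝ)
    (p : A → (Fin m → B) → R → (Fin m → Option Q) → ℝ) :
    ∑ r, ∑ qv : Fin m → Option Q, piBar πR πQ r qv *
      ∑ a, ∑ bv : Fin m → B, VBar V a bv r qv * p a bv r qv =
    (1 / m) * ∑ j, ∑ r, πR r * ∑ q, πQ q * ∑ a, ∑ bv : Fin m → B,
      V a (bv j) r q * p a bv r (dummyQ m j q) := by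
  have : ∀ r, _ := fun r => piBar_sum (m := m) πR πQ r
    (fun qv => ∑ a, ∑ bv : Fin m → B, VBar V a bv r qv * p a bv r qv)
  simp only [this, VBar_dummy]
  rw [Finset.sum_comm (s := (Finset.univ : Finset (Fin m))), Finset.mul_sum]
  refine Finset.sum_congr rfl fun r _ => ?_
  rw [← Finset.mul_sum]
  ring

lemma entropy_le [Fintype A] [Nonempty A] (al : A → ℝ) (h0 : ∀ a, 0 ≤ al a)
    (h1 : ∑ a, al a = 1) : ∑ a, Real.negMulLog (al a) ≤ Real.log (Fintype.card A) := by
  have hn : (0 : ℝ) < Fintype.card A := by exact_mod_cast Fintype.card_pos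
  have : ∀ a, Real.negMulLog (al a) ≤
      al a * Real.log (Fintype.card A) + (1 / Fintype.card A - al a) := by
    intro a
    rcases (h0 a).eq_or_lt with h | h
    · rw [← h]; simp
    · have h2 := Real.log_le_sub_one_of_pos (x := 1 / (Fintype.card A * al a)) (by positivity)
      rw [one_div, Real.log_inv, Real.log_mul hn.ne' h.ne'] at h2
      have h3 := mul_le_mul_of_nonneg_left h2 h.le
      have h4 : al a * ((Fintype.card A * al a)⁻¹ - 1) = 1 / Fintype.card A - al a := by
        field_simp
      rw [h4] at h3
      rw [Real.negMulLog]
      linarith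
  refine (Finset.sum_le_sum fun a _ => this a).trans (le_of_eq ?_)
  rw [Finset.sum_add_distrib, ← Finset.sum_mul, h1, Finset.sum_sub_distrib, h1]
  simp
  
lemma opt_lambda (m : ℕ) (hm : 0 < m) (L v w : ℝ) (hL : 0 ≤ L)
    (h : ∀ l : ℝ, 0 < l → m * v ≤ m * (w + l / 8) + (1 / l) * L) :
    v ≤ w + Real.sqrt (L / (2 * m)) := by
  have hm' : (0 : ℝ) < m := by exact_mod_cast hm
  rcases hL.eq_or_lt with h0 | hpos
  · rw [← h0]
    simp only [zero_div, Real.sqrt_zero, add_zero]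
    refine le_of_forall_pos_le_add fun e he => ?_
    have := h (8 * e) (by positivity)
    rw [← h0, mul_zero, add_zero] at this
    have := le_of_mul_le_mul_left this hm'
    linarith
  · set s := Real.sqrt (L / (2 * m)) with hs
    have hs0 : 0 < s := Real.sqrt_pos.mpr (by positivity)
    have hs2 : s * s = L / (2 * m) := Real.mul_self_sqrt (by positivity)
    have hLs : L = 2 * m * (s * s) := by rw [hs2]; field_simp
    have := h (4 * s) (by positivity)
    have e : (m : ℝ) * (w + 4 * s / 8) + 1 / (4 * s) * L = m * (w + s) := by
      rw [hLs]; field_simp; ring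
    rw [e] at this
    exact le_of_mul_le_mul_left this hm'

lemma ns_bound [Fintype R] [Fintype Q] [DecidableEq Q] [Fintype A] [DecidableEq A]
    [Fintype B] [DecidableEq B] [Nonempty A] [Nonempty B]
    {m : ℕ} (hm : 0 < m)
    (πR : R → ℝ) (hπR0 : ∀ r, 0 ≤ πR r) (hπR1 : (∑ r, πR r) = 1)
    (πQ : Q → ℝ) (hπQ0 : ∀ q, 0 ≤ πQ q) (hπQ1 : (∑ q, πQ q) = 1)
    (V : A → B → R → Q → ℝ) (hV : ∀ a b r q, V a b r q ∈ Set.Icc (0 : ℝ) 1) (w : ℝ)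
    (hw : ∀ (fa : R → A) (fb : Q → B), ∑ r, ∑ q, πR r * πQ q * V (fa r) (fb q) r q ≤ w)
    (p : A → (Fin m → B) → R → (Fin m → Option Q) → ℝ) (hp : IsNS p)
    (hmass : ∀ r qv, ∑ a, ∑ bv, p a bv r qv = 1) :
    ∑ r, ∑ qv : Fin m → Option Q, piBar πR πQ r qv *
      ∑ a, ∑ bv : Fin m → B, VBar V a bv r qv * p a bv r qv ≤
    w + Real.sqrt (Real.log (Fintype.card A) / (2 * m)) := by
  have hm' : (0 : ℝ) < m := by exact_mod_cast hm
  rw [nsBar_val]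
  refine opt_lambda m hm _ _ _ (Real.log_nonneg (by exact_mod_cast Fintype.card_pos)) ?_
  intro l hl
  have h1 := ns_induct πR hπR0 hπR1 πQ hπQ0 hπQ1 V hV w hw l hl m p 1 hp hmass
  rw [← mul_assoc, mul_one_div_cancel hm'.ne', one_mul]
  refine h1.trans ?_
  rw [mul_one]
  gcongr
  calc _ ≤ ∑ r, πR r * Real.log (Fintype.card A) := by
        refine Finset.sum_le_sum fun r _ => mul_le_mul_of_nonneg_left ?_ (hπR0 r)
        rw [Real.negMulLog_one, sub_zero]
        exact entropy_le _ (fun a => Finset.sum_nonneg fun bv _ => hp.nn _ _ _ _) (hmass r _)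
    _ = _ := by rw [← Finset.sum_mul, hπR1, one_mul]

theorem free_game_immunization
    [Fintype R] [Fintype Q] [DecidableEq Q] [Fintype A] [DecidableEq A]
    [Fintype B] [DecidableEq B] [Nonempty A] [Nonempty B]
    {m : ℕ} (hm : 0 < m)
    (πR : R → ℝ) (hπR0 : ∀ r, 0 ≤ πR r) (hπR1 : (∑ r, πR r) = 1)
    (πQ : Q → ℝ) (hπQ0 : ∀ q, 0 ≤ πQ q) (hπQ1 : (∑ q, πQ q) = 1)
    (V : A → B → R → Q → ℝ) (hV : ∀ a b r q, V a b r q ∈ Set.Icc (0 : ℝ) 1) :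
    cValueG πR πQ V = cValueGBar (m := m) πR πQ V ∧
    cValueGBar (m := m) πR πQ V ≤ entValueGBar (m := m) πR πQ V ∧
    entValueGBar (m := m) πR πQ V ≤ nsValueGBar (m := m) πR πQ V ∧
    nsValueGBar (m := m) πR πQ V ≤
      cValueG πR πQ V + Real.sqrt (Real.log (Fintype.card A) / (2 * m)) := by
  have hm' : (0 : ℝ) < m := by exact_mod_cast hm
  have hone : ∀ (fa : R → A) (fb : Q → B),
      ∑ r, ∑ q, πR r * πQ q * V (fa r) (fb q) r q ≤ 1 := by
    intro fa fb
    calc _ ≤ ∑ r, ∑ q, πR r * πQ q := Finset.sum_le_sum fun r _ => Finset.sum_le_sum fun q _ =>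
          mul_le_of_le_one_right (mul_nonneg (hπR0 r) (hπQ0 q)) (hV _ _ _ _).2
      _ = 1 := by simp only [← Finset.mul_sum, hπQ1, mul_one, hπR1]
  have hw : ∀ (fa : R → A) (fb : Q → B),
      ∑ r, ∑ q, πR r * πQ q * V (fa r) (fb q) r q ≤ cValueG πR πQ V := by
    intro fa fb
    refine le_csSup ⟨1, ?_⟩ ⟨fa, fb, rfl⟩
    rintro v ⟨fa, fb, rfl⟩
    exact hone fa fb
  have hcbar : ∀ (fa : R → A) (fb : Fin m → Option Q → B),
      ∑ r, ∑ qv : Fin m → Option Q,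
        piBar πR πQ r qv * VBar V (fa r) (fun j => fb j (qv j)) r qv ≤ cValueG πR πQ V := by
    intro fa fb
    rw [cBar_val, one_div, inv_mul_le_iff₀ hm']
    refine (Finset.sum_le_sum fun j _ => hw fa fun q => fb j (some q)).trans (le_of_eq ?_)
    simp
  obtain ⟨a0⟩ := ‹Nonempty A›
  obtain ⟨b0⟩ := ‹Nonempty B›
  -- entangled strategies are non-signaling
  have hsub : ∀ v, v ∈ {v : ℝ |
    ∃ (d0 : ℕ) (d : Fin m → ℕ) (ψ : (Fin d0 × ∀ j, Fin (d j)) → ℂ)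
      (M0 : R → A → Matrix (Fin d0) (Fin d0) ℂ)
      (M : ∀ j, Option Q → B → Matrix (Fin (d j)) (Fin (d j)) ℂ),
      (∑ t : Fin d0 × ∀ j, Fin (d j), Complex.normSq (ψ t)) = 1 ∧
      (∀ r a, (M0 r a).PosSemidef) ∧ (∀ r, (∑ a, M0 r a) = 1) ∧
      (∀ j oq b, (M j oq b).PosSemidef) ∧ (∀ j oq, (∑ b, M j oq b) = 1) ∧
      v = (∑ r, ∑ qv : Fin m → Option Q, (piBar πR πQ r qv : ℂ) *
            ∑ a, ∑ bv : Fin m → B, (VBar V a bv r qv : ℂ) *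
              ∑ s : Fin d0 × ∀ j, Fin (d j), ∑ t : Fin d0 × ∀ j, Fin (d j),
                (starRingEnd ℂ) (ψ s) * (M0 r a s.1 t.1 *
                  ∏ j, M j (qv j) (bv j) (s.2 j) (t.2 j)) * ψ t).re} → 
      v ∈ {v : ℝ | ∃ p : A → (Fin m → B) → R → (Fin m → Option Q) → ℝ,
    (∀ a bv r qv, 0 ≤ p a bv r qv) ∧
    (∀ r qv, (∑ a, ∑ bv : Fin m → B, p a bv r qv) = 1) ∧
    (∀ (bv : Fin m → B) (r r' : R) (qv : Fin m → Option Q),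
      (∑ a, p a bv r qv) = ∑ a, p a bv r' qv) ∧
    (∀ (j : Fin m) (a : A) (bv : Fin m → B) (r : R) (qv : Fin m → Option Q)
        (x : Option Q),
      (∑ c : B, p a (Function.update bv j c) r qv) =
        ∑ c : B, p a (Function.update bv j c) r (Function.update qv j x)) ∧
    v = ∑ r, ∑ qv : Fin m → Option Q, piBar πR πQ r qv *
      ∑ a, ∑ bv : Fin m → B, VBar V a bv r qv * p a bv r qv} := by
    rintro v ⟨d0, d, ψ, M0, M, hψ, hM0, hM01, hM, hM1, rfl⟩
    refine ⟨fun a bv r qv => (evT ψ (M0 r a) (fun j => M j (qv j) (bv j))).re, ?_, ?_, ?_, ?_, ?_⟩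
    · intro a bv r qv
      exact evT_nonneg _ _ _ (hM0 r a) fun j => hM _ _ _
    · intro r qv
      simp only [← Complex.re_sum]
      rw [Finset.sum_congr rfl fun a _ => evT_sum_all ψ (M0 r a) (fun j b => M j (qv j) b),
        evT_sum0, hM01]
      simp only [hM1]
      rw [evT_one, hψ]
      simp
    · intro bv r r' qv
      simp only [← Complex.re_sum]
      rw [evT_sum0, evT_sum0, hM01, hM01]
    · intro j a bv r qv x
      simp only [← Complex.re_sum]
      have e : ∀ (qv' : Fin m → Option Q) (c : B),
          (fun i => M i (qv' i) (Function.update bv j c i)) =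
          Function.update (fun i => M i (qv' i) (bv i)) j (M j (qv' j) c) := by
        intro qv' c
        funext i
        by_cases h : i = j
        · subst h; simp
        · simp [Function.update_of_ne h]
      simp only [e]
      rw [evT_sum_slot, evT_sum_slot, hM1, hM1]
      congr 2
      funext i
      by_cases h : i = j
      · subst h; simp
      · simp [Function.update_of_ne h]
    · rw [Complex.re_sum]
      refine Finset.sum_congr rfl fun r _ => ?_
      rw [Complex.re_sum]
      refine Finset.sum_congr rfl fun qv _ => ?_
      rw [Complex.re_ofReal_mul, Complex.re_sum]
      congr 1
      refine Finset.sum_congr rfl fun a _ => ?_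
      rw [Complex.re_sum]
      refine Finset.sum_congr rfl fun bv _ => ?_
      rw [Complex.re_ofReal_mul]
      rfl
  -- deterministic strategies are entangled
  have hdet : ∀ (fa : R → A) (fb : Fin m → Option Q → B),
      ∃ (d0 : ℕ) (d : Fin m → ℕ) (ψ : (Fin d0 × ∀ j, Fin (d j)) → ℂ)
      (M0 : R → A → Matrix (Fin d0) (Fin d0) ℂ)
      (M : ∀ j, Option Q → B → Matrix (Fin (d j)) (Fin (d j)) ℂ),
      (∑ t : Fin d0 × ∀ j, Fin (d j), Complex.normSq (ψ t)) = 1 ∧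
      (∀ r a, (M0 r a).PosSemidef) ∧ (∀ r, (∑ a, M0 r a) = 1) ∧
      (∀ j oq b, (M j oq b).PosSemidef) ∧ (∀ j oq, (∑ b, M j oq b) = 1) ∧
      ∑ r, ∑ qv : Fin m → Option Q,
        piBar πR πQ r qv * VBar V (fa r) (fun j => fb j (qv j)) r qv =
          (∑ r, ∑ qv : Fin m → Option Q, (piBar πR πQ r qv : ℂ) *
            ∑ a, ∑ bv : Fin m → B, (VBar V a bv r qv : ℂ) *
              ∑ s : Fin d0 × ∀ j, Fin (d j), ∑ t : Fin d0 × ∀ j, Fin (d j),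
                (starRingEnd ℂ) (ψ s) * (M0 r a s.1 t.1 *
                  ∏ j, M j (qv j) (bv j) (s.2 j) (t.2 j)) * ψ t).re := by
    intro fa fb
    refine ⟨1, fun _ => 1, fun _ => 1, fun r a => if a = fa r then 1 else 0,
      fun j oq b => if b = fb j oq then 1 else 0, ?_, ?_, ?_, ?_, ?_, ?_⟩
    · simp
    · intro r a
      dsimp only
      split_ifs
      · exact Matrix.PosSemidef.one
      · exact Matrix.PosSemidef.zero
    · intro r; simp
    · intro j oq b
      dsimp only
      split_ifs
      · exact Matrix.PosSemidef.one
      · exact Matrix.PosSemidef.zero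
    · intro j oq; simp
    · have e1 : ∀ (r : R) (a : A) (x y : Fin 1),
          (if a = fa r then (1 : Matrix (Fin 1) (Fin 1) ℂ) else 0) x y =
            if a = fa r then 1 else 0 := by
        intro r a x y
        rw [Subsingleton.elim x y]
        split_ifs <;> simp
      have e2 : ∀ (j : Fin m) (oq : Option Q) (b : B) (x y : Fin 1),
          (if b = fb j oq then (1 : Matrix (Fin 1) (Fin 1) ℂ) else 0) x y =
            if b = fb j oq then 1 else 0 := by
        intro j oq b x y
        rw [Subsingleton.elim x y]
        split_ifs <;> simp
      have e3 : ∀ (qv : Fin m → Option Q) (bv : Fin m → B),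
          (∏ j, if bv j = fb j (qv j) then (1 : ℂ) else 0) =
            if bv = fun j => fb j (qv j) then 1 else 0 := by
        intro qv bv
        rw [Finset.prod_ite_zero]
        simp [funext_iff]
      simp only [e1, e2, e3]
      simp
  have hbound : ∀ v, v ∈ {v : ℝ | ∃ p : A → (Fin m → B) → R → (Fin m → Option Q) → ℝ,
    (∀ a bv r qv, 0 ≤ p a bv r qv) ∧
    (∀ r qv, (∑ a, ∑ bv : Fin m → B, p a bv r qv) = 1) ∧
    (∀ (bv : Fin m → B) (r r' : R) (qv : Fin m → Option Q),
      (∑ a, p a bv r qv) = ∑ a, p a bv r' qv) ∧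
    (∀ (j : Fin m) (a : A) (bv : Fin m → B) (r : R) (qv : Fin m → Option Q)
        (x : Option Q),
      (∑ c : B, p a (Function.update bv j c) r qv) =
        ∑ c : B, p a (Function.update bv j c) r (Function.update qv j x)) ∧
    v = ∑ r, ∑ qv : Fin m → Option Q, piBar πR πQ r qv *
      ∑ a, ∑ bv : Fin m → B, VBar V a bv r qv * p a bv r qv} →
      v ≤ cValueG πR πQ V + Real.sqrt (Real.log (Fintype.card A) / (2 * m)) := by
    rintro v ⟨p, h1, h2, h3, h4, rfl⟩
    have : Nonempty A := ⟨a0⟩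
    have : Nonempty B := ⟨b0⟩
    exact ns_bound hm πR hπR0 hπR1 πQ hπQ0 hπQ1 V hV _ hw p ⟨h1, h3, h4⟩ h2
  refine ⟨?_, ?_, ?_, ?_⟩
  · apply le_antisymm
    · refine csSup_le ⟨_, fun _ => a0, fun _ => b0, rfl⟩ ?_
      rintro v ⟨fa, fb, rfl⟩
      refine le_csSup ⟨cValueG πR πQ V, ?_⟩
        ⟨fa, fun _ oq => oq.elim b0 fb, ?_⟩
      · rintro v ⟨fa, fb, rfl⟩
        exact hcbar fa fb
      · refine Eq.trans ?_ (cBar_val πR πQ V fa (fun _ oq => oq.elim b0 fb)).symm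
        simp only [Option.elim_some]
        simp only [Finset.sum_const, Finset.card_univ, Fintype.card_fin, nsmul_eq_mul]
        field_simp
    · refine csSup_le ⟨_, fun _ => a0, fun _ _ => b0, rfl⟩ ?_
      rintro v ⟨fa, fb, rfl⟩
      exact hcbar fa fb
  · refine csSup_le ⟨_, fun _ => a0, fun _ _ => b0, rfl⟩ ?_
    rintro v ⟨fa, fb, rfl⟩
    exact le_csSup ⟨_, fun v hv => hbound v (hsub v hv)⟩ (hdet fa fb)
  · refine csSup_le ⟨_, hdet (fun _ => a0) (fun _ _ => b0)⟩ ?_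
    intro v hv
    exact le_csSup ⟨_, fun v hv => hbound v hv⟩ (hsub v hv)
  · refine csSup_le ⟨_, hsub _ (hdet (fun _ => a0) (fun _ _ => b0))⟩ ?_
    intro v hv
    exact hbound v hv

end
end

section
/- Let G(2, π, V) be a two-player one-round free game with π = π_R × π_Q a product distribution on R × Q and payoff V on A × B × R × Q (first player's answers in A). Then for every m-extendible non-signaling conditional distribution p(a, b | r, q), the value achieved by p satisfies Σ_{r,q} π_R(r) π_Q(q) Σ_{a,b} V(a, b | r, q) p(a, b | r, q) ≤ ω_c(G) + √( ln|A| / (2m) ). In particular, m-extendible non-signaling strategies give at most a √(ln|A|/(2m)) advantage over classical strategies for free games. -/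
/- Monogamy of non-locality for free games: for a two-player one-round free game
   G(2, π_R × π_Q, V) and any m-extendible non-signaling strategy p(a,b|r,q),
   Σ_{r,q} π_R(r)π_Q(q) Σ_{a,b} V(a,b|r,q) p(a,b|r,q) ≤ ω_c(G) + √(ln|A|/(2m)). -/

open scoped BigOperators

noncomputable section

variable {X Y A B : Type}

/-- Non-signaling for a conditional distribution on one X-system and k Y-systems. -/
def IsNonSignalingExt {X Y A B : Type} [Fintype X] [Fintype Y] {k : ℕ}
    (P : X → (Fin k → Y) → A → (Fin k → B) → ℝ) : Prop :=
  (∀ (yv : Fin k → Y) (a a' : A) (bv : Fin k → B),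
      (∑ x, P x yv a bv) = ∑ x, P x yv a' bv) ∧
  (∀ (j : Fin k) (x : X) (yv : Fin k → Y) (a : A) (bv : Fin k → B) (b' : B),
      (∑ c : Y, P x (Function.update yv j c) a bv) =
        ∑ c : Y, P x (Function.update yv j c) a (Function.update bv j b'))

/-- p(x,y|a,b) is k-extendible: there is a non-signaling conditional distribution
    P(x,y₁,…,y_k|a,b₁,…,b_k), invariant under simultaneous permutations of the pairs
    (y_j, b_j), whose marginal on each (x, y_j | a, b_j) is p. -/
def IsExtendibleNS {X Y A B : Type} [Fintype X] [Fintype Y] [DecidableEq Y]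
    (k : ℕ) (p : X → Y → A → B → ℝ) : Prop :=
  ∃ P : X → (Fin k → Y) → A → (Fin k → B) → ℝ,
    (∀ x yv a bv, 0 ≤ P x yv a bv) ∧
    (∀ a bv, (∑ x, ∑ yv : Fin k → Y, P x yv a bv) = 1) ∧
    IsNonSignalingExt P ∧
    (∀ (π : Equiv.Perm (Fin k)) (x : X) (yv : Fin k → Y) (a : A) (bv : Fin k → B),
      P x (yv ∘ π) a (bv ∘ π) = P x yv a bv) ∧
    (∀ (j : Fin k) (x : X) (y : Y) (a : A) (bv : Fin k → B),
      (∑ g : {i : Fin k // i ≠ j} → Y,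
        P x (fun i => if h : i = j then y else g ⟨i, h⟩) a bv) = p x y a (bv j))

/-- The classical value of the two-player game with question distribution π_R × π_Q and
    payoff V (answers of the first player in A, of the second in B). -/
noncomputable def classicalValue2 {R Q A B : Type} [Fintype R] [Fintype Q]
    (πR : R → ℝ) (πQ : Q → ℝ) (V : A → B → R → Q → ℝ) : ℝ :=
  sSup {v : ℝ | ∃ (fa : R → A) (fb : Q → B),
    v = ∑ r, ∑ q, πR r * πQ q * V (fa r) (fb q) r q}

lemma hoeffding_fin {A : Type} [Fintype A] (w g : A → ℝ) (hw0 : ∀ a, 0 ≤ w a)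
    (hw1 : ∑ a, w a = 1) (hg : ∀ a, g a ∈ Set.Icc (0 : ℝ) 1) (t : ℝ) :
    ∑ a, w a * Real.exp (t * g a) ≤ Real.exp (t * (∑ a, w a * g a) + t ^ 2 / 8) := by
  letI : MeasurableSpace A := ⊤
  have h1 : ∑ a, ENNReal.ofReal (w a) = 1 := by
    rw [← ENNReal.ofReal_sum_of_nonneg (fun a _ => hw0 a), hw1, ENNReal.ofReal_one]
  let μ := (PMF.ofFintype (fun a => ENNReal.ofReal (w a)) h1).toMeasure
  have hint : ∀ f : A → ℝ, ∫ a, f a ∂μ = ∑ a, w a * f a := by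
    intro f
    rw [PMF.integral_eq_sum]
    refine Finset.sum_congr rfl fun a _ => ?_
    simp [ENNReal.toReal_ofReal (hw0 a)]
  have key := (ProbabilityTheory.hasSubgaussianMGF_of_mem_Icc (μ := μ) (X := g) (a := 0) (b := 1)
    (measurable_from_top.aemeasurable) (Filter.Eventually.of_forall hg)).mgf_le t
  rw [ProbabilityTheory.mgf, hint, hint] at key
  set x := ∑ a, w a * g a with hx
  have e1 : ∑ a, w a * Real.exp (t * (g a - x))
      = (∑ a, w a * Real.exp (t * g a)) * Real.exp (- (t * x)) := by
    rw [Finset.sum_mul]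
    refine Finset.sum_congr rfl fun a _ => ?_
    rw [mul_assoc, ← Real.exp_add]; congr 2; ring
  rw [e1] at key
  have e2 : ∑ a, w a * Real.exp (t * g a)
      = (∑ a, w a * Real.exp (t * g a)) * Real.exp (- (t * x)) * Real.exp (t * x) := by
    rw [mul_assoc, ← Real.exp_add]; simp
  rw [e2, add_comm, Real.exp_add]
  refine mul_le_mul_of_nonneg_right (key.trans (le_of_eq ?_)) (Real.exp_nonneg _)
  congr 1
  simp
  ring

/-- Exponential weights. -/
def hedgeW {A : Type} [Fintype A] (t : ℝ) (g : ℕ → A → ℝ) (n : ℕ) (a : A) : ℝ :=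
  Real.exp (t * ∑ i ∈ Finset.range n, g i a) /
    ∑ a', Real.exp (t * ∑ i ∈ Finset.range n, g i a')

lemma hedgeZ_pos {A : Type} [Fintype A] [Nonempty A] (t : ℝ) (g : ℕ → A → ℝ) (n : ℕ) :
    0 < ∑ a', Real.exp (t * ∑ i ∈ Finset.range n, g i a') :=
  Finset.sum_pos (fun _ _ => Real.exp_pos _) Finset.univ_nonempty

lemma hedgeW_nonneg {A : Type} [Fintype A] [Nonempty A] (t : ℝ) (g : ℕ → A → ℝ) (n : ℕ) (a : A) :
    0 ≤ hedgeW t g n a :=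
  div_nonneg (Real.exp_nonneg _) (hedgeZ_pos t g n).le

lemma hedgeW_sum {A : Type} [Fintype A] [Nonempty A] (t : ℝ) (g : ℕ → A → ℝ) (n : ℕ) :
    ∑ a, hedgeW t g n a = 1 := by
  unfold hedgeW
  rw [← Finset.sum_div, div_self (hedgeZ_pos t g n).ne']

lemma hedgeZ_le {A : Type} [Fintype A] [Nonempty A] (t : ℝ) (g : ℕ → A → ℝ)
    (hg : ∀ n a, g n a ∈ Set.Icc (0 : ℝ) 1) (n : ℕ) :
    ∑ a', Real.exp (t * ∑ i ∈ Finset.range n, g i a') ≤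
      Fintype.card A * Real.exp (t * (∑ i ∈ Finset.range n, ∑ a, hedgeW t g i a * g i a)
        + n * (t ^ 2 / 8)) := by
  induction n with
  | zero => simp
  | succ n ih =>
    have h := hoeffding_fin (hedgeW t g n) (g n) (hedgeW_nonneg t g n) (hedgeW_sum t g n) (hg n) t
    have e : ∑ a', Real.exp (t * ∑ i ∈ Finset.range (n + 1), g i a') =
        (∑ a', Real.exp (t * ∑ i ∈ Finset.range n, g i a')) *
          ∑ a, hedgeW t g n a * Real.exp (t * g n a) := by
      rw [Finset.mul_sum]
      refine Finset.sum_congr rfl fun a _ => ?_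
      rw [Finset.sum_range_succ, mul_add, Real.exp_add, hedgeW]
      have := (hedgeZ_pos t g n).ne'
      field_simp
    rw [e]
    refine (mul_le_mul ih h (Finset.sum_nonneg fun a _ =>
      mul_nonneg (hedgeW_nonneg t g n a) (Real.exp_nonneg _)) (by positivity)).trans
      (le_of_eq ?_)
    rw [mul_assoc, ← Real.exp_add, Finset.sum_range_succ]
    congr 2
    push_cast
    ring

lemma hedge_regret {A : Type} [Fintype A] [Nonempty A] (t : ℝ) (ht : 0 < t) (g : ℕ → A → ℝ)
    (hg : ∀ n a, g n a ∈ Set.Icc (0 : ℝ) 1) (n : ℕ) (a : A) :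
    ∑ i ∈ Finset.range n, g i a ≤ (∑ i ∈ Finset.range n, ∑ a, hedgeW t g i a * g i a)
      + (Real.log (Fintype.card A) / t + n * (t / 8)) := by
  have h1 : Real.exp (t * ∑ i ∈ Finset.range n, g i a) ≤ _ :=
    (Finset.single_le_sum (f := fun a' => Real.exp (t * ∑ i ∈ Finset.range n, g i a'))
      (fun _ _ => Real.exp_nonneg _) (Finset.mem_univ a)).trans (hedgeZ_le t g hg n)
  have hc : (0 : ℝ) < Fintype.card A := by exact_mod_cast Fintype.card_pos
  rw [← Real.exp_log hc, ← Real.exp_add, Real.exp_le_exp] at h1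
  refine le_of_mul_le_mul_left (h1.trans (le_of_eq ?_)) ht
  field_simp
  ring

/-- Exchange a coordinate with an external variable. -/
def swapEquiv {k : ℕ} {Y : Type} (j : Fin k) : ((Fin k → Y) × Y) ≃ ((Fin k → Y) × Y) where
  toFun z := (Function.update z.1 j z.2, z.1 j)
  invFun z := (Function.update z.1 j z.2, z.1 j)
  left_inv z := by simp
  right_inv z := by simp

lemma sum_swap {k : ℕ} {Y : Type} [Fintype Y] (j : Fin k) (F : (Fin k → Y) → Y → ℝ) :
    ∑ v, ∑ c, F v c = ∑ v, ∑ c, F (Function.update v j c) (v j) := by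
  rw [← Fintype.sum_prod_type', ← Fintype.sum_prod_type']
  exact (Equiv.sum_comp (swapEquiv j) (fun z : (Fin k → Y) × Y => F z.1 z.2)).symm

lemma prod_swap {k : ℕ} {Q : Type} (πQ : Q → ℝ) (j : Fin k) (v : Fin k → Q) (c : Q) :
    (∏ i, πQ (Function.update v j c i)) * πQ (v j) = (∏ i, πQ (v i)) * πQ c := by
  rw [Fintype.prod_eq_mul_prod_compl j, Fintype.prod_eq_mul_prod_compl j (fun i => πQ (v i))]
  have : ∏ i ∈ {j}ᶜ, πQ (Function.update v j c i) = ∏ i ∈ {j}ᶜ, πQ (v i) := by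
    refine Finset.prod_congr rfl fun i hi => ?_
    rw [Function.update_of_ne (by simpa using hi)]
  rw [this]; simp; ring

lemma resample {k : ℕ} {Q : Type} [Fintype Q] (πQ : Q → ℝ) (hπQ1 : ∑ q, πQ q = 1) (j : Fin k)
    (G : (Fin k → Q) → Q → ℝ) (hG : ∀ v c q, G (Function.update v j c) q = G v q) :
    ∑ v : Fin k → Q, (∏ i, πQ (v i)) * G v (v j) =
      ∑ v : Fin k → Q, (∏ i, πQ (v i)) * ∑ q, πQ q * G v q := by
  have e : ∑ v : Fin k → Q, (∏ i, πQ (v i)) * ∑ q, πQ q * G v q =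
      ∑ v : Fin k → Q, ∑ q, ((∏ i, πQ (v i)) * πQ q) * G v q := by
    refine Finset.sum_congr rfl fun v _ => ?_
    rw [Finset.mul_sum]
    exact Finset.sum_congr rfl fun q _ => by ring
  rw [e, sum_swap j]
  refine Finset.sum_congr rfl fun v _ => ?_
  simp_rw [prod_swap, hG]
  rw [← Finset.sum_mul, ← Finset.mul_sum, hπQ1, mul_one]

lemma prodW_sum {k : ℕ} {Q : Type} [Fintype Q] (πQ : Q → ℝ) (hπQ1 : ∑ q, πQ q = 1) :
    ∑ v : Fin k → Q, (∏ i, πQ (v i)) = 1 := by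
  classical
  rw [← Fintype.prod_sum (fun (_ : Fin k) q => πQ q)]
  simp [hπQ1]

lemma ns_sum {k : ℕ} {B Q : Type} [Fintype B] [Nonempty B]
    (M : (Fin k → B) → (Fin k → Q) → ℝ) (j : Fin k)
    (hM : ∀ bv qv q', ∑ c, M (Function.update bv j c) qv =
      ∑ c, M (Function.update bv j c) (Function.update qv j q'))
    (φ : (Fin k → B) → ℝ) (hφ : ∀ bv c, φ (Function.update bv j c) = φ bv)
    (qv : Fin k → Q) (q' : Q) :
    ∑ bv, M bv (Function.update qv j q') * φ bv = ∑ bv, M bv qv * φ bv := by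
  have key : ∀ N : (Fin k → B) → ℝ, (Fintype.card B : ℝ) * ∑ bv, N bv * φ bv =
      ∑ bv, (∑ c, N (Function.update bv j c)) * φ bv := by
    intro N
    have h := sum_swap j (fun (bv : Fin k → B) (_ : B) => N bv * φ bv)
    simp only [Finset.sum_const, Finset.card_univ, nsmul_eq_mul, ← Finset.mul_sum, hφ] at h
    rw [h]
    exact Finset.sum_congr rfl fun bv _ => by rw [Finset.sum_mul]
  have hc : (Fintype.card B : ℝ) ≠ 0 := by exact_mod_cast Fintype.card_ne_zero
  apply mul_left_cancel₀ hc
  rw [key, key (fun bv => M bv qv)]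
  exact Finset.sum_congr rfl fun bv _ => by rw [hM bv qv q']

lemma round_bound {k : ℕ} {B Q : Type} [Fintype B] [Nonempty B] [Fintype Q]
    (πQ : Q → ℝ) (hπQ0 : ∀ q, 0 ≤ πQ q) (hπQ1 : ∑ q, πQ q = 1)
    (M : (Fin k → B) → (Fin k → Q) → ℝ) (hM0 : ∀ bv qv, 0 ≤ M bv qv)
    (hM1 : ∀ qv, ∑ bv, M bv qv = 1) (j : Fin k)
    (hM : ∀ bv qv q', ∑ c, M (Function.update bv j c) qv =
      ∑ c, M (Function.update bv j c) (Function.update qv j q'))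
    (f : (Fin k → Q) → (Fin k → B) → B → Q → ℝ)
    (hfQ : ∀ qv bv c b q, f (Function.update qv j c) bv b q = f qv bv b q)
    (hfB : ∀ qv bv c b q, f qv (Function.update bv j c) b q = f qv bv b q)
    (ω : ℝ) (hω : ∀ qv bv (fb : Q → B), ∑ q, πQ q * f qv bv (fb q) q ≤ ω) :
    ∑ qv : Fin k → Q, (∏ i, πQ (qv i)) * ∑ bv, M bv qv * f qv bv (bv j) (qv j) ≤ ω := by
  have hex : ∀ qv bv q, ∃ b0, ∀ b, f qv bv b q ≤ f qv bv b0 q := fun qv bv q =>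
    Finite.exists_max (fun b => f qv bv b q)
  let F : (Fin k → Q) → (Fin k → B) → Q → ℝ := fun qv bv q => ⨆ b, f qv bv b q
  have hFQ : ∀ qv bv c q, F (Function.update qv j c) bv q = F qv bv q := by
    intro qv bv c q; simp only [F, hfQ]
  have hFB : ∀ qv bv c q, F qv (Function.update bv j c) q = F qv bv q := by
    intro qv bv c q; simp only [F, hfB]
  have hfF : ∀ qv bv b q, f qv bv b q ≤ F qv bv q := fun qv bv b q =>
    le_ciSup (f := fun b => f qv bv b q) (Set.finite_range _).bddAbove b
  have hFω : ∀ qv bv, ∑ q, πQ q * F qv bv q ≤ ω := by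
    intro qv bv
    choose fb hfb using hex qv bv
    refine le_trans (Finset.sum_le_sum fun q _ => ?_) (hω qv bv fb)
    exact mul_le_mul_of_nonneg_left (ciSup_le (hfb q)) (hπQ0 q)
  have hW0 : ∀ qv : Fin k → Q, 0 ≤ ∏ i, πQ (qv i) := fun qv => Finset.prod_nonneg fun i _ => hπQ0 _
  calc _ ≤ ∑ qv : Fin k → Q, (∏ i, πQ (qv i)) * ∑ bv, M bv qv * F qv bv (qv j) := by
        refine Finset.sum_le_sum fun qv _ => mul_le_mul_of_nonneg_left ?_ (hW0 qv)
        exact Finset.sum_le_sum fun bv _ => mul_le_mul_of_nonneg_left (hfF _ _ _ _) (hM0 _ _)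
    _ = ∑ qv : Fin k → Q, (∏ i, πQ (qv i)) * ∑ q, πQ q * ∑ bv, M bv qv * F qv bv q := by
        refine resample πQ hπQ1 j (fun qv q => ∑ bv, M bv qv * F qv bv q) ?_
        intro v c q
        simp only [hFQ]
        exact ns_sum M j hM (fun bv => F v bv q) (fun bv c => hFB v bv c q) v c
    _ ≤ ∑ qv : Fin k → Q, (∏ i, πQ (qv i)) * ω := by
        refine Finset.sum_le_sum fun qv _ => mul_le_mul_of_nonneg_left ?_ (hW0 qv)
        have : ∑ q, πQ q * ∑ bv, M bv qv * F qv bv q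
            = ∑ bv, M bv qv * ∑ q, πQ q * F qv bv q := by
          simp_rw [Finset.mul_sum]
          rw [Finset.sum_comm]
          exact Finset.sum_congr rfl fun _ _ => Finset.sum_congr rfl fun _ _ => by ring
        rw [this]
        calc _ ≤ ∑ bv, M bv qv * ω :=
              Finset.sum_le_sum fun bv _ => mul_le_mul_of_nonneg_left (hFω _ _) (hM0 _ _)
          _ = ω := by rw [← Finset.sum_mul, hM1, one_mul]
    _ = ω := by rw [← Finset.sum_mul, prodW_sum πQ hπQ1, one_mul]

lemma mixed_le {R Q A B : Type} [Fintype R] [Fintype Q] [Fintype A] [Fintype B] [Nonempty A]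
    (πR : R → ℝ) (hπR0 : ∀ r, 0 ≤ πR r) (πQ : Q → ℝ) (V : A → B → R → Q → ℝ)
    (w : R → A → ℝ) (hw0 : ∀ r a, 0 ≤ w r a) (hw1 : ∀ r, ∑ a, w r a = 1) (fb : Q → B) :
    ∑ q, πQ q * ∑ r, πR r * ∑ a, w r a * V a (fb q) r q ≤ classicalValue2 πR πQ V := by
  have hex : ∀ r, ∃ a0, ∀ a, ∑ q, πQ q * V a (fb q) r q ≤ ∑ q, πQ q * V a0 (fb q) r q :=
    fun r => Finite.exists_max (fun a => ∑ q, πQ q * V a (fb q) r q)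
  choose fa hfa using hex
  have hb : BddAbove {v : ℝ | ∃ (fa : R → A) (fb : Q → B),
      v = ∑ r, ∑ q, πR r * πQ q * V (fa r) (fb q) r q} := by
    refine ((Set.finite_range (fun z : (R → A) × (Q → B) =>
      ∑ r, ∑ q, πR r * πQ q * V (z.1 r) (z.2 q) r q)).subset ?_).bddAbove
    rintro v ⟨fa, fb, rfl⟩
    exact ⟨(fa, fb), rfl⟩
  refine le_trans ?_ (le_csSup hb ⟨fa, fb, rfl⟩)
  have e : ∑ q, πQ q * ∑ r, πR r * ∑ a, w r a * V a (fb q) r q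
      = ∑ r, πR r * ∑ a, w r a * ∑ q, πQ q * V a (fb q) r q := by
    simp_rw [Finset.mul_sum]
    rw [Finset.sum_comm]
    refine Finset.sum_congr rfl fun r _ => ?_
    rw [Finset.sum_comm]
    exact Finset.sum_congr rfl fun _ _ => Finset.sum_congr rfl fun _ _ => by ring
  rw [e]
  refine Finset.sum_le_sum fun r _ => ?_
  simp_rw [mul_assoc]
  rw [← Finset.mul_sum]
  refine mul_le_mul_of_nonneg_left ?_ (hπR0 r)
  calc _ ≤ ∑ a, w r a * ∑ q, πQ q * V (fa r) (fb q) r q :=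
        Finset.sum_le_sum fun a _ => mul_le_mul_of_nonneg_left (hfa r a) (hw0 r a)
    _ = _ := by rw [← Finset.sum_mul, hw1, one_mul]

lemma marg_sum {k : ℕ} {B : Type} [Fintype B] [DecidableEq B] (j : Fin k)
    (N : (Fin k → B) → ℝ) (f : B → ℝ) :
    ∑ bv, N bv * f (bv j) = ∑ b, (∑ g : {i : Fin k // i ≠ j} → B,
        N (fun i => if h : i = j then b else g ⟨i, h⟩)) * f b := by
  rw [← Equiv.sum_comp (Equiv.funSplitAt j B).symm, Fintype.sum_prod_type]
  refine Finset.sum_congr rfl fun b _ => ?_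
  rw [Finset.sum_mul]
  refine Finset.sum_congr rfl fun g _ => ?_
  have : (Equiv.funSplitAt j B).symm (b, g) = (fun i => if h : i = j then b else g ⟨i, h⟩) := by
    ext i
    simp [Equiv.funSplitAt]
  rw [this]
  simp

lemma main_eta
    {R Q A B : Type} [Fintype R] [Fintype Q] [Fintype A] [Fintype B]
    [DecidableEq B] [Nonempty A] [Nonempty B]
    {m : ℕ}
    (πR : R → ℝ) (hπR0 : ∀ r, 0 ≤ πR r) (hπR1 : (∑ r, πR r) = 1)
    (πQ : Q → ℝ) (hπQ0 : ∀ q, 0 ≤ πQ q) (hπQ1 : (∑ q, πQ q) = 1)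
    (V : A → B → R → Q → ℝ) (hV : ∀ a b r q, V a b r q ∈ Set.Icc (0 : ℝ) 1)
    (p : A → B → R → Q → ℝ)
    (hext : IsExtendibleNS m p) (t : ℝ) (ht : 0 < t) :
    m * (∑ r, ∑ q, πR r * πQ q * ∑ a, ∑ b, V a b r q * p a b r q) ≤
      m * classicalValue2 πR πQ V + (Real.log (Fintype.card A) / t + m * (t / 8)) := by
  obtain ⟨P, hP0, hP1, ⟨hnsA, hnsB⟩, -, hmarg⟩ := hext
  have hR : Nonempty R := by
    by_contra h
    rw [not_nonempty_iff] at h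
    simp at hπR1
  obtain ⟨r0⟩ := hR
  set C := Real.log (Fintype.card A) / t + m * (t / 8) with hC
  let g : R → (Fin m → B) → (Fin m → Q) → ℕ → A → ℝ := fun r bv qv n a =>
    if h : n < m then V a (bv ⟨n, h⟩) r (qv ⟨n, h⟩) else 0
  let w : Fin m → R → (Fin m → B) → (Fin m → Q) → A → ℝ := fun j r bv qv a =>
    hedgeW t (g r bv qv) j a
  let f : Fin m → (Fin m → Q) → (Fin m → B) → B → Q → ℝ := fun j qv bv b q =>
    ∑ r, πR r * ∑ a, w j r bv qv a * V a b r q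
  let M : (Fin m → B) → (Fin m → Q) → ℝ := fun bv qv => ∑ a, P a bv r0 qv
  have hregret : ∀ r bv qv a, ∑ j : Fin m, V a (bv j) r (qv j) ≤
      (∑ j : Fin m, ∑ a', w j r bv qv a' * V a' (bv j) r (qv j)) + C := by
    intro r bv qv a
    have h := hedge_regret t ht (g r bv qv) (by
      intro n a
      simp only [g]
      split_ifs
      · exact hV _ _ _ _
      · simp) m a
    rw [Finset.sum_range, Finset.sum_range] at h
    simpa [g, w] using h
  have hgcongr : ∀ (j : Fin m) r bv bv' qv qv' a, (∀ i, i < j → bv i = bv' i) →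
      (∀ i, i < j → qv i = qv' i) → w j r bv qv a = w j r bv' qv' a := by
    intro j r bv bv' qv qv' a h1 h2
    have : ∀ a, ∑ i ∈ Finset.range j, g r bv qv i a = ∑ i ∈ Finset.range j, g r bv' qv' i a := by
      intro a
      refine Finset.sum_congr rfl fun i hi => ?_
      have hi' : i < (j : ℕ) := by simpa using hi
      have him : i < m := hi'.trans j.2
      simp only [g, him, dite_true]
      rw [h1 ⟨i, him⟩ hi', h2 ⟨i, him⟩ hi']
    simp only [w, hedgeW, this]
  have hround : ∀ j : Fin m, ∑ qv : Fin m → Q, (∏ i, πQ (qv i)) *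
      ∑ bv, M bv qv * f j qv bv (bv j) (qv j) ≤ classicalValue2 πR πQ V := by
    intro j
    refine round_bound πQ hπQ0 hπQ1 M (fun bv qv => Finset.sum_nonneg fun a _ => hP0 _ _ _ _)
      (fun qv => by simp only [M]; rw [Finset.sum_comm]; exact hP1 r0 qv) j ?_ (f j) ?_ ?_ _ ?_
    · intro bv qv q'
      simp only [M]
      rw [Finset.sum_comm, Finset.sum_comm (s := Finset.univ (α := B))]
      exact Finset.sum_congr rfl fun a _ => hnsB j a bv r0 qv q'
    · intro qv bv c b q
      simp only [f]
      refine Finset.sum_congr rfl fun r _ => ?_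
      congr 1
      refine Finset.sum_congr rfl fun a _ => ?_
      congr 1
      exact hgcongr j r _ _ _ _ a (fun _ _ => rfl)
        (fun i hi => Function.update_of_ne hi.ne _ _)
    · intro qv bv c b q
      simp only [f]
      refine Finset.sum_congr rfl fun r _ => ?_
      congr 1
      refine Finset.sum_congr rfl fun a _ => ?_
      congr 1
      exact hgcongr j r _ _ _ _ a (fun i hi => Function.update_of_ne hi.ne _ _) (fun _ _ => rfl)
    · intro qv bv fb
      exact mixed_le πR hπR0 πQ V (fun r => w j r bv qv)
        (fun r a => hedgeW_nonneg _ _ _ _) (fun r => hedgeW_sum _ _ _) fb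
  have hW0 : ∀ qv : Fin m → Q, 0 ≤ ∏ i, πQ (qv i) := fun qv => Finset.prod_nonneg fun i _ => hπQ0 _
  -- inequality for fixed questions
  have hfix : ∀ r qv, ∑ j : Fin m, ∑ a, ∑ b, V a b r (qv j) * p a b r (qv j) ≤
      (∑ j : Fin m, ∑ bv, M bv qv * ∑ a', w j r bv qv a' * V a' (bv j) r (qv j)) + C := by
    intro r qv
    have e1 : ∑ j : Fin m, ∑ a, ∑ b, V a b r (qv j) * p a b r (qv j) =
        ∑ a, ∑ bv, P a bv r qv * ∑ j : Fin m, V a (bv j) r (qv j) := by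
      rw [Finset.sum_comm]
      refine Finset.sum_congr rfl fun a _ => ?_
      simp_rw [Finset.mul_sum]
      rw [Finset.sum_comm (s := Finset.univ (α := Fin m → B))]
      refine Finset.sum_congr rfl fun j _ => ?_
      rw [marg_sum j (fun bv => P a bv r qv) (fun b => V a b r (qv j))]
      refine Finset.sum_congr rfl fun b _ => ?_
      rw [hmarg, mul_comm]
    have e2 : (∑ j : Fin m, ∑ bv, M bv qv * ∑ a', w j r bv qv a' * V a' (bv j) r (qv j)) + C =
        ∑ a, ∑ bv, P a bv r qv *
          ((∑ j : Fin m, ∑ a', w j r bv qv a' * V a' (bv j) r (qv j)) + C) := by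
      simp_rw [mul_add, Finset.sum_add_distrib]
      congr 1
      · rw [Finset.sum_comm, Finset.sum_comm (s := Finset.univ (α := A))]
        refine Finset.sum_congr rfl fun bv _ => ?_
        rw [← Finset.mul_sum, ← Finset.sum_mul]
        congr 1
        exact hnsA bv r0 r qv
      · simp_rw [← Finset.sum_mul]
        rw [hP1, one_mul]
    rw [e1, e2]
    exact Finset.sum_le_sum fun a _ => Finset.sum_le_sum fun bv _ =>
      mul_le_mul_of_nonneg_left (hregret r bv qv a) (hP0 _ _ _ _)
  have hval : ∀ r (j : Fin m), ∑ qv : Fin m → Q, (∏ i, πQ (qv i)) *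
      ∑ a, ∑ b, V a b r (qv j) * p a b r (qv j) =
      ∑ q, πQ q * ∑ a, ∑ b, V a b r q * p a b r q := by
    intro r j
    rw [resample πQ hπQ1 j (fun _ q => ∑ a, ∑ b, V a b r q * p a b r q) (fun _ _ _ => rfl),
      ← Finset.sum_mul, prodW_sum πQ hπQ1, one_mul]
  calc (m : ℝ) * (∑ r, ∑ q, πR r * πQ q * ∑ a, ∑ b, V a b r q * p a b r q)
      = ∑ r, πR r * ∑ qv : Fin m → Q, (∏ i, πQ (qv i)) *
          ∑ j : Fin m, ∑ a, ∑ b, V a b r (qv j) * p a b r (qv j) := by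
        rw [Finset.mul_sum]
        refine Finset.sum_congr rfl fun r _ => ?_
        simp_rw [mul_assoc]
        rw [← Finset.mul_sum, mul_left_comm]
        congr 1
        have : ∀ qv : Fin m → Q, (∏ i, πQ (qv i)) *
            ∑ j : Fin m, ∑ a, ∑ b, V a b r (qv j) * p a b r (qv j) = ∑ j : Fin m,
            (∏ i, πQ (qv i)) * ∑ a, ∑ b, V a b r (qv j) * p a b r (qv j) :=
          fun qv => Finset.mul_sum _ _ _
        rw [Finset.sum_congr rfl fun qv _ => this qv, Finset.sum_comm,
          Finset.sum_congr rfl fun j _ => hval r j]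
        simp
    _ ≤ ∑ r, πR r * ∑ qv : Fin m → Q, (∏ i, πQ (qv i)) *
          ((∑ j : Fin m, ∑ bv, M bv qv * ∑ a', w j r bv qv a' * V a' (bv j) r (qv j)) + C) :=
        Finset.sum_le_sum fun r _ => mul_le_mul_of_nonneg_left
          (Finset.sum_le_sum fun qv _ => mul_le_mul_of_nonneg_left (hfix r qv) (hW0 qv)) (hπR0 r)
    _ = (∑ j : Fin m, ∑ qv : Fin m → Q, (∏ i, πQ (qv i)) *
          ∑ bv, M bv qv * f j qv bv (bv j) (qv j)) + C := by
        simp_rw [mul_add, Finset.sum_add_distrib, mul_add, Finset.sum_add_distrib]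
        congr 1
        · simp only [f]
          generalize hU : (fun j r bv qv => ∑ a', w j r bv qv a' * V a' (bv j) r (qv j)) = U
          have hU' : ∀ j r bv qv, ∑ a', w j r bv qv a' * V a' (bv j) r (qv j) = U j r bv qv := by
            intro j r bv qv; rw [← hU]
          simp_rw [hU', Finset.mul_sum]
          rw [Finset.sum_comm, Finset.sum_comm (s := Finset.univ (α := Fin m))]
          refine Finset.sum_congr rfl fun qv _ => ?_
          rw [Finset.sum_comm]
          refine Finset.sum_congr rfl fun j _ => ?_
          rw [Finset.sum_comm]
          exact Finset.sum_congr rfl fun _ _ => Finset.sum_congr rfl fun _ _ => by ring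
        · simp_rw [← Finset.sum_mul]
          rw [prodW_sum πQ hπQ1, one_mul, hπR1, one_mul]
    _ ≤ m * classicalValue2 πR πQ V + C := by
        gcongr
        refine (Finset.sum_le_sum fun j _ => hround j).trans (le_of_eq ?_)
        simp

theorem extendible_strategies_free_games
    {R Q A B : Type} [Fintype R] [Fintype Q] [Fintype A] [Fintype B]
    [DecidableEq A] [DecidableEq B] [Nonempty A] [Nonempty B]
    {m : ℕ} (hm : 0 < m)
    (πR : R → ℝ) (hπR0 : ∀ r, 0 ≤ πR r) (hπR1 : (∑ r, πR r) = 1)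
    (πQ : Q → ℝ) (hπQ0 : ∀ q, 0 ≤ πQ q) (hπQ1 : (∑ q, πQ q) = 1)
    (V : A → B → R → Q → ℝ) (hV : ∀ a b r q, V a b r q ∈ Set.Icc (0 : ℝ) 1)
    (p : A → B → R → Q → ℝ)
    (hp0 : ∀ a b r q, 0 ≤ p a b r q) (hp1 : ∀ r q, (∑ a, ∑ b, p a b r q) = 1)
    (hns : (∀ a r q q', (∑ b, p a b r q) = ∑ b, p a b r q') ∧
           (∀ b r r' q, (∑ a, p a b r q) = ∑ a, p a b r' q))
    (hext : IsExtendibleNS m p) :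
    (∑ r, ∑ q, πR r * πQ q * ∑ a, ∑ b, V a b r q * p a b r q) ≤
      classicalValue2 πR πQ V + Real.sqrt (Real.log (Fintype.card A) / (2 * m)) := by
  set ω := classicalValue2 πR πQ V
  set val := ∑ r, ∑ q, πR r * πQ q * ∑ a, ∑ b, V a b r q * p a b r q
  set L := Real.log (Fintype.card A) with hL
  have hm' : (0 : ℝ) < m := by exact_mod_cast hm
  have hmain : ∀ t : ℝ, 0 < t → m * val ≤ m * ω + (L / t + m * (t / 8)) := fun t ht =>
    main_eta πR hπR0 hπR1 πQ hπQ0 hπQ1 V hV p hext t ht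
  have hL0 : 0 ≤ L := Real.log_natCast_nonneg _
  set s := Real.sqrt (L / (2 * m)) with hs
  have hs2 : s ^ 2 = L / (2 * m) := Real.sq_sqrt (by positivity)
  have hs0 : 0 ≤ s := Real.sqrt_nonneg _
  have hLs : L = 2 * m * s ^ 2 := by rw [hs2]; field_simp
  rcases hs0.eq_or_lt with h0 | hpos
  · have hLz : L = 0 := by rw [hLs, ← h0]; ring
    rw [← h0, add_zero]
    refine le_of_forall_pos_le_add fun ε hε => ?_
    have h := hmain (8 * ε) (by positivity)
    rw [hLz, zero_div] at h
    refine le_of_mul_le_mul_left (h.trans (le_of_eq ?_)) hm'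
    ring
  · have h := hmain (4 * s) (by positivity)
    refine le_of_mul_le_mul_left (h.trans (le_of_eq ?_)) hm'
    rw [hLs]
    field_simp
    ring

end
end
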